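/- arXiv:0801.2650 — 2 statements merged into one kernel-verified Lean document; each statement's English description precedes it below -/
import Mathlib

section
/- Let σ : (ℝ²,0) → (ℝ²,0) be a bi-Lipschitz homeomorphism germ, and let f, g : (ℝ²,0) → (ℝ,0) be real analytic germs, mini-regular in x, with f = g ∘ σ on a neighbourhood of the origin. Let γ : x = λ(y) and γ̃ : x = λ̃(y) be allowable real analytic demi-branches, and suppose there exist ξ₀ ≥ 1 and N > 0 such that σ(γ) ⊂ H_{ξ₀}(γ̃; N) as germs at the origin. Fix ξ with 1 ≤ ξ ≤ ξ₀, and suppose f admits along γ the expansion (e, P) at rate ξ and g admits along γ̃ the expansion (ẽ, Q) at rate ξ, where P and Q are nonzero polynomials. Then e = ẽ and deg P = deg Q. -/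
open Filter Topology Polynomial

noncomputable section

/-- A bi-Lipschitz homeomorphism germ at the origin of the plane. -/
def IsBiLipschitzGerm (σ : ℝ × ℝ → ℝ × ℝ) : Prop :=
  σ 0 = 0 ∧ ∃ (U V : Set (ℝ × ℝ)) (τ : ℝ × ℝ → ℝ × ℝ) (K : NNReal),
    IsOpen U ∧ IsOpen V ∧ (0 : ℝ × ℝ) ∈ U ∧ (0 : ℝ × ℝ) ∈ V ∧
    Set.MapsTo σ U V ∧ Set.MapsTo τ V U ∧
    (∀ x ∈ U, τ (σ x) = x) ∧ (∀ y ∈ V, σ (τ y) = y) ∧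
    LipschitzOnWith K σ U ∧ LipschitzOnWith K τ V

/-- An allowable real analytic demi-branch `x = λ(y)`, `y ≥ 0`. -/
def AllowableBranch (lam : ℝ → ℝ) : Prop :=
  ∃ (N : ℕ) (μ : ℝ → ℝ), 0 < N ∧ AnalyticAt ℝ μ 0 ∧ μ 0 = 0 ∧
    (∀ᶠ y in 𝓝[≥] (0 : ℝ), lam y = μ (y ^ ((N : ℝ)⁻¹))) ∧
    ∃ C > (0 : ℝ), ∀ᶠ y in 𝓝[≥] (0 : ℝ), |lam y| ≤ C * y

/-- The horn neighbourhood `H_ξ(γ; N)` of the demi-branch `x = λ(y)`. -/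
def Horn (ξ : ℝ) (lam : ℝ → ℝ) (N : ℝ) : Set (ℝ × ℝ) :=
  {p : ℝ × ℝ | 0 < p.2 ∧ |p.1 - lam p.2| ≤ N * p.2 ^ ξ}

/-- `f` admits along the demi-branch `x = λ(y)` the expansion `(e, P)` at rate `ξ`:
`f(λ(y) + z·y^ξ, y) = P(z)·y^e + o(y^e)` uniformly for `z` in compact sets. -/
def AdmitsExpansion (f : ℝ × ℝ → ℝ) (lam : ℝ → ℝ) (ξ e : ℝ) (P : Polynomial ℝ) : Prop :=
  ∀ R > (0 : ℝ), ∀ ε > (0 : ℝ), ∀ᶠ y in 𝓝[>] (0 : ℝ), ∀ z : ℝ, |z| ≤ R →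
    |f (lam y + z * y ^ ξ, y) - P.eval z * y ^ e| ≤ ε * y ^ e

/-- `f` is mini-regular in `x`: its initial homogeneous form does not vanish at `(1,0)`. -/
def MiniRegularInX (f : ℝ × ℝ → ℝ) : Prop :=
  ∃ m : ℕ, (∀ j < m, iteratedFDeriv ℝ j f 0 = 0) ∧
    iteratedFDeriv ℝ m f 0 (fun _ => ((1 : ℝ), (0 : ℝ))) ≠ 0

theorem AllowableBranch.exists_lipschitz {lam : ℝ → ℝ} (h : AllowableBranch lam) :
    lam 0 = 0 ∧ ∃ δ > 0, ∃ L ≥ 0, ∀ s ∈ Set.Icc 0 δ, ∀ t ∈ Set.Icc 0 δ,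
      |lam s - lam t| ≤ L * |s - t| := by
  obtain ⟨N, μ, hN, hμ, hμ0, hlam, C, hC, hbd⟩ := h
  have hN' : N ≠ 0 := hN.ne'
  have hlam0 : lam 0 = 0 := by
    have := hlam.self_of_nhdsWithin (by simp)
    rw [this, Real.zero_rpow (by positivity), hμ0]
  refine ⟨hlam0, ?_⟩
  have hpow : Tendsto (fun t : ℝ => t ^ N) (𝓝[>] 0) (𝓝[≥] 0) := by
    apply tendsto_nhdsWithin_iff.2
    constructor
    · have : Tendsto (fun t : ℝ => t ^ N) (𝓝 0) (𝓝 (0 ^ N)) := (continuous_pow N).tendsto 0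
      rw [zero_pow hN'] at this
      exact this.mono_left nhdsWithin_le_nhds
    · filter_upwards [self_mem_nhdsWithin] with t ht
      exact pow_nonneg (Set.mem_Ioi.1 ht).le N
  have hμbd : ∀ᶠ t in 𝓝[>] (0 : ℝ), |μ t| ≤ C * t ^ N := by
    filter_upwards [hpow.eventually hlam, hpow.eventually hbd, self_mem_nhdsWithin]
      with t h1 h2 h3
    rw [Real.pow_rpow_inv_natCast (Set.mem_Ioi.1 h3).le hN'] at h1
    rwa [h1] at h2
  have hord : (N : ℕ∞) ≤ analyticOrderAt μ 0 := by
    by_contra! hlt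
    obtain ⟨k, hk⟩ := ENat.ne_top_iff_exists.1 (ne_top_of_lt hlt)
    rw [← hk] at hlt
    have hkN : k < N := by exact_mod_cast hlt
    obtain ⟨ν, hν, hν0, hμν⟩ := (hμ.analyticOrderAt_eq_natCast).1 hk.symm
    apply hν0
    have h1 : Tendsto (fun t => |ν t|) (𝓝[>] 0) (𝓝 |ν 0|) :=
      (hν.continuousAt.abs).tendsto.mono_left nhdsWithin_le_nhds
    have h2 : Tendsto (fun t : ℝ => C * t ^ (N - k)) (𝓝[>] 0) (𝓝 0) := by
      have : Tendsto (fun t : ℝ => C * t ^ (N - k)) (𝓝 0) (𝓝 (C * 0 ^ (N - k))) :=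
        Continuous.tendsto (by fun_prop) 0
      rw [zero_pow (by omega), mul_zero] at this
      exact this.mono_left nhdsWithin_le_nhds
    have h3 : |ν 0| ≤ 0 := by
      refine le_of_tendsto_of_tendsto h1 h2 ?_
      filter_upwards [hμbd, hμν.filter_mono nhdsWithin_le_nhds, self_mem_nhdsWithin]
        with t ht1 ht2 ht3
      have ht3 : 0 < t := ht3
      rw [ht2, sub_zero, smul_eq_mul, abs_mul, abs_of_pos (pow_pos ht3 k)] at ht1
      have : t ^ N = t ^ k * t ^ (N - k) := by rw [← pow_add]; congr 1; omega
      rw [this] at ht1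
      refine le_of_mul_le_mul_left (a := t ^ k) ?_ (pow_pos ht3 k)
      linarith
    exact abs_nonpos_iff.1 h3
  obtain ⟨ν, hν, hμν⟩ := (natCast_le_analyticOrderAt hμ).1 hord
  obtain ⟨L, T, hT, hL⟩ := (hν.contDiffAt (n := 1)).exists_lipschitzOnWith
  obtain ⟨a, ha, haT⟩ := Metric.eventually_nhds_iff.1
    ((show ∀ᶠ t in 𝓝 (0 : ℝ), t ∈ T from hT).and hμν)
  have hlam' : ∀ᶠ y in 𝓝[>] (0 : ℝ), lam y = μ (y ^ ((N : ℝ)⁻¹)) :=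
    hlam.filter_mono (nhdsWithin_mono _ Set.Ioi_subset_Ici_self)
  obtain ⟨b, hb, hbl⟩ := mem_nhdsGT_iff_exists_Ioo_subset.1 hlam'
  have hb : 0 < b := hb
  set c := min (a / 2) 1 with hc
  have hc0 : 0 < c := by positivity
  have hca : c < a := (min_le_left _ _).trans_lt (by linarith)
  have hc1 : c ≤ 1 := min_le_right _ _
  have key : ∀ s ∈ Set.Icc 0 c, ∀ t ∈ Set.Icc 0 c,
      |μ s - μ t| ≤ (|ν 0| + 2 * L) * |s ^ N - t ^ N| := by
    suffices H : ∀ s ∈ Set.Icc 0 c, ∀ t ∈ Set.Icc 0 c, t ≤ s →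
        |μ s - μ t| ≤ (|ν 0| + 2 * L) * |s ^ N - t ^ N| by
      intro s hs t ht
      rcases le_total t s with h | h
      · exact H s hs t ht h
      · rw [abs_sub_comm, abs_sub_comm (s ^ N)]
        exact H t ht s hs h
    intro s hs t ht hts
    have hds : dist s 0 < a := by
      rw [Real.dist_eq, sub_zero, abs_of_nonneg hs.1]; linarith [hs.2]
    have hdt : dist t 0 < a := by
      rw [Real.dist_eq, sub_zero, abs_of_nonneg ht.1]; linarith [ht.2]
    obtain ⟨hsT, hμs⟩ := haT hds
    obtain ⟨htT, hμt⟩ := haT hdt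
    obtain ⟨h0T, -⟩ := haT (y := 0) (by simpa using ha)
    have e1 := hL.dist_le_mul s hsT t htT
    have e2 := hL.dist_le_mul s hsT 0 h0T
    rw [Real.dist_eq, Real.dist_eq] at e1 e2
    rw [sub_zero, abs_of_nonneg hs.1] at e2
    have hL0 : (0 : ℝ) ≤ L := L.2
    have e3 : |ν s| ≤ |ν 0| + L := by
      have : |ν s| ≤ |ν s - ν 0| + |ν 0| := by
        simpa using abs_add_le (ν s - ν 0) (ν 0)
      have : (L : ℝ) * s ≤ L * 1 := by gcongr; exact hs.2.trans hc1
      linarith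
    have hst : t ^ N ≤ s ^ N := pow_le_pow_left₀ ht.1 hts N
    have e4 : t ^ N * (s - t) ≤ s ^ N - t ^ N := by
      obtain ⟨n, rfl⟩ : ∃ n, N = n + 1 := ⟨N - 1, by omega⟩
      have h1 : t ^ n ≤ s ^ n := pow_le_pow_left₀ ht.1 hts n
      have h2 : t ^ (n + 1) ≤ t ^ n :=
        pow_le_pow_of_le_one ht.1 (ht.2.trans hc1) (Nat.le_succ n)
      calc t ^ (n + 1) * (s - t) ≤ t ^ n * (s - t) :=
            mul_le_mul_of_nonneg_right h2 (by linarith)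
        _ ≤ s ^ (n + 1) - t ^ (n + 1) := by
          rw [pow_succ, pow_succ]
          nlinarith [mul_le_mul_of_nonneg_right h1 hs.1]
    rw [hμs, hμt, sub_zero, sub_zero, smul_eq_mul, smul_eq_mul]
    have e5 : s ^ N * ν s - t ^ N * ν t = (s ^ N - t ^ N) * ν s + t ^ N * (ν s - ν t) := by ring
    rw [e5]
    have htN : 0 ≤ t ^ N := pow_nonneg ht.1 N
    calc |(s ^ N - t ^ N) * ν s + t ^ N * (ν s - ν t)|
        ≤ |s ^ N - t ^ N| * |ν s| + t ^ N * |ν s - ν t| := by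
          refine (abs_add_le _ _).trans ?_
          rw [abs_mul, abs_mul, abs_of_nonneg htN]
      _ ≤ |s ^ N - t ^ N| * (|ν 0| + L) + t ^ N * (L * |s - t|) := by gcongr
      _ ≤ (|ν 0| + 2 * L) * |s ^ N - t ^ N| := by
          rw [abs_of_nonneg (sub_nonneg.2 hts), abs_of_nonneg (sub_nonneg.2 hst)]
          nlinarith [mul_le_mul_of_nonneg_left e4 hL0]
  have hNinv : (0 : ℝ) < (N : ℝ)⁻¹ := by positivity
  refine ⟨min (b / 2) (c ^ N), by positivity, |ν 0| + 2 * L, by positivity, ?_⟩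
  have root : ∀ y ∈ Set.Icc 0 (min (b / 2) (c ^ N)),
      lam y = μ (y ^ ((N : ℝ)⁻¹)) ∧ y ^ ((N : ℝ)⁻¹) ∈ Set.Icc 0 c ∧
        (y ^ ((N : ℝ)⁻¹)) ^ N = y := by
    intro y hy
    have hy1 : y ≤ b / 2 := hy.2.trans (min_le_left _ _)
    have hy2 : y ≤ c ^ N := hy.2.trans (min_le_right _ _)
    refine ⟨?_, ⟨Real.rpow_nonneg hy.1 _, ?_⟩, Real.rpow_inv_natCast_pow hy.1 hN'⟩
    · rcases hy.1.eq_or_lt with h | h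
      · rw [← h, hlam0, Real.zero_rpow hNinv.ne', hμ0]
      · exact hbl ⟨h, by linarith⟩
    · calc y ^ ((N : ℝ)⁻¹) ≤ (c ^ N) ^ ((N : ℝ)⁻¹) :=
            Real.rpow_le_rpow hy.1 hy2 hNinv.le
        _ = c := Real.pow_rpow_inv_natCast hc0.le hN'
  intro s hs t ht
  obtain ⟨h1, h2, h3⟩ := root s hs
  obtain ⟨h4, h5, h6⟩ := root t ht
  have := key _ h2 _ h5
  rwa [h3, h6, ← h1, ← h4] at this

theorem Polynomial.exists_abs_eval_bounds {P : ℝ[X]} (hP : P ≠ 0) :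
    ∃ c > 0, ∃ C > 0, ∃ Z ≥ 1, ∀ z : ℝ, Z ≤ |z| →
      c * |z| ^ P.natDegree ≤ |P.eval z| ∧ |P.eval z| ≤ C * |z| ^ P.natDegree := by
  set l := |P.leadingCoeff| with hl
  have hl0 : 0 < l := abs_pos.2 (leadingCoeff_ne_zero.2 hP)
  have hlim : Tendsto (fun w => |P.reverse.eval w|) (𝓝 0) (𝓝 l) := by
    have : Continuous fun w => |P.reverse.eval w| := P.reverse.continuous.abs
    have h := this.tendsto 0
    rwa [← coeff_zero_eq_eval_zero, coeff_zero_reverse] at h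
  obtain ⟨r, hr, hb⟩ := Metric.eventually_nhds_iff.1
    (hlim.eventually (Ioo_mem_nhds (show l / 2 < l by linarith) (show l < 2 * l by linarith)))
  refine ⟨l / 2, by positivity, 2 * l, by positivity, max 1 (2 / r), le_max_left _ _, ?_⟩
  intro z hz
  have hz1 : 1 ≤ |z| := (le_max_left _ _).trans hz
  have hz2 : 2 / r ≤ |z| := (le_max_right _ _).trans hz
  have hz0 : z ≠ 0 := abs_pos.1 (by linarith)
  have hd : dist z⁻¹ 0 < r := by
    rw [Real.dist_eq, sub_zero, abs_inv, inv_lt_comm₀ (by linarith) hr]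
    refine lt_of_lt_of_le ?_ hz2
    rw [inv_eq_one_div]
    gcongr
    norm_num
  have heval : P.eval z = P.reverse.eval z⁻¹ * z ^ P.natDegree := by
    let := invertibleOfNonzero hz0
    have := eval₂_reverse_mul_pow (RingHom.id ℝ) z P
    rw [invOf_eq_inv] at this
    exact this.symm
  obtain ⟨h1, h2⟩ := hb hd
  rw [heval, abs_mul, abs_pow]
  exact ⟨by gcongr, by gcongr⟩

theorem eventually_rpow_le {a b A : ℝ} (hab : b < a) (hA : 0 < A) :
    ∀ᶠ y in 𝓝[>] (0 : ℝ), y ^ a ≤ A * y ^ b := by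
  have h : Tendsto (fun y : ℝ => y ^ (a - b)) (𝓝[>] 0) (𝓝 0) := by
    have := (Real.continuousAt_rpow_const 0 (a - b) (Or.inr (by linarith))).tendsto
    rw [Real.zero_rpow (by linarith)] at this
    exact this.mono_left nhdsWithin_le_nhds
  filter_upwards [h.eventually_le_const hA, self_mem_nhdsWithin] with y hy hy0
  have hy0 : 0 < y := hy0
  have : y ^ a = y ^ (a - b) * y ^ b := by rw [← Real.rpow_add hy0]; congr 1; ring
  rw [this]
  gcongr

/-- Bounds of size `z ^ d * y ^ e` for all large `z` determine the exponents. -/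
theorem exponents_le {A Z e e' : ℝ} {d d' : ℕ} (hA : 0 < A)
    (h : ∀ z ≥ Z, ∀ᶠ y in 𝓝[>] (0 : ℝ), z ^ d * y ^ e ≤ A * (z ^ d' * y ^ e')) :
    e' ≤ e ∧ (e = e' → d ≤ d') := by
  constructor
  · by_contra! hlt
    set z := max Z 1
    have hz : 0 < z := lt_max_of_lt_right one_pos
    have hB : 0 < z ^ d / (2 * (A * z ^ d')) := by positivity
    obtain ⟨y, h1, h2, h3⟩ := ((h z (le_max_left _ _)).and
      ((eventually_rpow_le hlt hB).and self_mem_nhdsWithin)).exists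
    have h3 : 0 < y := h3
    have hy : 0 < y ^ e := Real.rpow_pos_of_pos h3 e
    have h4 : A * z ^ d' * y ^ e' ≤ A * z ^ d' * (z ^ d / (2 * (A * z ^ d')) * y ^ e) := by
      gcongr
    have h5 : A * z ^ d' * (z ^ d / (2 * (A * z ^ d')) * y ^ e) = z ^ d * y ^ e / 2 := by
      field_simp
    have : 0 < z ^ d * y ^ e := by positivity
    nlinarith
  · rintro rfl
    have h' : ∀ z ≥ Z, z ^ d ≤ A * z ^ d' := by
      intro z hz
      obtain ⟨y, h1, h3⟩ := ((h z hz).and self_mem_nhdsWithin).exists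
      have hy : 0 < y ^ e := Real.rpow_pos_of_pos h3 e
      refine le_of_mul_le_mul_right ?_ hy
      linarith
    by_contra! hlt
    set z := max (max Z 1) (2 * A)
    have hz1 : 1 ≤ z := (le_max_right _ _).trans (le_max_left _ _)
    have hz2 : 2 * A ≤ z := le_max_right _ _
    have h1 := h' z ((le_max_left _ _).trans (le_max_left _ _))
    have h2 : z ^ (d' + 1) ≤ z ^ d := pow_le_pow_right₀ hz1 hlt
    have h3 : 0 < z ^ d' := by positivity
    rw [pow_succ] at h2
    nlinarith

theorem exponents_eq {c C c' C' Z e e' : ℝ} {d d' : ℕ}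
    (hc : 0 < c) (hC : 0 < C) (hc' : 0 < c') (hC' : 0 < C')
    (h : ∀ z ≥ Z, ∀ᶠ y in 𝓝[>] (0 : ℝ), c * (z ^ d * y ^ e) ≤ C * (z ^ d' * y ^ e') ∧
      c' * (z ^ d' * y ^ e') ≤ C' * (z ^ d * y ^ e)) :
    e = e' ∧ d = d' := by
  have h1 : e' ≤ e ∧ (e = e' → d ≤ d') :=
    exponents_le (A := C / c) (Z := Z) (by positivity) fun z hz => (h z hz).mono fun y hy => by
      rw [div_mul_eq_mul_div, le_div_iff₀ hc, mul_comm _ c]; exact hy.1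
  have h2 : e ≤ e' ∧ (e' = e → d' ≤ d) :=
    exponents_le (A := C' / c') (Z := Z) (by positivity) fun z hz => (h z hz).mono fun y hy => by
      rw [div_mul_eq_mul_div, le_div_iff₀ hc', mul_comm _ c']; exact hy.2
  have he := le_antisymm h2.1 h1.1
  exact ⟨he, le_antisymm (h1.2 he) (h2.2 he.symm)⟩

theorem AdmitsExpansion.exists_bounds {f : ℝ × ℝ → ℝ} {lam : ℝ → ℝ} {ξ e : ℝ} {P : ℝ[X]}
    (h : AdmitsExpansion f lam ξ e P) (hP : P ≠ 0) :
    ∃ c > 0, ∃ C > 0, ∃ Z ≥ 1, ∀ R > 0, ∀ᶠ y in 𝓝[>] (0 : ℝ), ∀ z : ℝ, Z ≤ |z| → |z| ≤ R →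
      c * (|z| ^ P.natDegree * y ^ e) ≤ |f (lam y + z * y ^ ξ, y)| ∧
      |f (lam y + z * y ^ ξ, y)| ≤ C * (|z| ^ P.natDegree * y ^ e) := by
  obtain ⟨c, hc, C, hC, Z, hZ, hb⟩ := P.exists_abs_eval_bounds hP
  refine ⟨c / 2, by positivity, C + c / 2, by positivity, Z, hZ, fun R hR => ?_⟩
  filter_upwards [h R hR (c / 2) (by positivity), self_mem_nhdsWithin] with y hy hy0 z hz hzR
  have hye : 0 < y ^ e := Real.rpow_pos_of_pos hy0 e
  have h1 := hy z hzR
  obtain ⟨h2, h3⟩ := hb z hz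
  have h4 : 1 ≤ |z| ^ P.natDegree := one_le_pow₀ (hZ.trans hz)
  have h5 : |P.eval z * y ^ e| = |P.eval z| * y ^ e := by rw [abs_mul, abs_of_pos hye]
  have h6 := abs_sub_abs_le_abs_sub (f (lam y + z * y ^ ξ, y)) (P.eval z * y ^ e)
  have h7 := abs_sub_abs_le_abs_sub (P.eval z * y ^ e) (f (lam y + z * y ^ ξ, y))
  rw [abs_sub_comm] at h7
  rw [h5] at h6 h7
  have h8 := mul_le_mul_of_nonneg_right h2 hye.le
  have h9 := mul_le_mul_of_nonneg_right h3 hye.le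
  have h10 : c / 2 * y ^ e ≤ c / 2 * (|z| ^ P.natDegree * y ^ e) := by
    have := mul_le_mul_of_nonneg_right h4 hye.le
    rw [one_mul] at this
    gcongr
  constructor <;> linarith

/-- The order of vanishing at the origin of a germ mini-regular in `x`, in metric terms. -/
theorem MiniRegularInX.exists_bounds {f : ℝ × ℝ → ℝ} (hfm : MiniRegularInX f)
    (hf : AnalyticAt ℝ f 0) :
    ∃ m : ℕ, ∃ c > 0, ∃ C > 0, ∃ δ > 0, ∀ᶠ p in 𝓝 (0 : ℝ × ℝ), |f p| ≤ C * ‖p‖ ^ m ∧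
      (|p.2| ≤ δ * |p.1| → c * |p.1| ^ m ≤ |f p|) := by
  obtain ⟨m, hlow, hm⟩ := hfm
  obtain ⟨p, r, hp⟩ := hf
  have hzero : ∀ j < m, ∀ y, p j (fun _ => y) = 0 := by
    intro j hj y
    have h := hp.factorial_smul y j
    rw [hlow j hj, zero_apply] at h
    exact (smul_eq_zero.1 h).resolve_left (Nat.factorial_ne_zero j)
  set F : ℝ × ℝ → ℝ := fun y => p m (fun _ => y) with hF
  have hFc : Continuous F := (p m).cont.comp (continuous_pi fun _ => continuous_id)
  have hF1 : F (1, 0) ≠ 0 := by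
    intro h0
    have h := hp.factorial_smul ((1 : ℝ), (0 : ℝ)) m
    apply hm
    rw [← h]
    simp only [hF] at h0
    rw [h0, smul_zero]
  have hFhom : ∀ (t : ℝ) (y : ℝ × ℝ), F (t • y) = t ^ m * F y := by
    intro t y
    have := (p m).map_smul_univ (fun _ => t) (fun _ => y)
    simpa [hF] using this
  set l := |F (1, 0)| with hl
  have hl0 : 0 < l := abs_pos.2 hF1
  have hlim : Tendsto (fun s : ℝ => |F (1, s)|) (𝓝 0) (𝓝 l) := by
    have : Continuous fun s : ℝ => |F (1, s)| := by fun_prop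
    exact this.tendsto 0
  obtain ⟨a, ha, hba⟩ := Metric.eventually_nhds_iff.1
    (hlim.eventually (Ioi_mem_nhds (show l / 2 < l by linarith)))
  obtain ⟨A, hA, hO⟩ := (hp.hasFPowerSeriesAt.isBigO_sub_partialSum_pow (m + 1)).exists_pos
  have hrem : ∀ᶠ y in 𝓝 (0 : ℝ × ℝ), |f y - F y| ≤ A * ‖y‖ ^ (m + 1) := by
    filter_upwards [hO.bound] with y hy
    have hs : p.partialSum (m + 1) y = F y := by
      rw [FormalMultilinearSeries.partialSum, Finset.sum_range_succ,
        Finset.sum_eq_zero fun j hj => hzero j (Finset.mem_range.1 hj) y, zero_add]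
    rw [hs, zero_add, norm_pow, norm_norm] at hy
    exact hy
  have hsmall : ∀ᶠ y in 𝓝 (0 : ℝ × ℝ), ‖y‖ < min 1 (l / (4 * A)) := by
    have := Metric.ball_mem_nhds (0 : ℝ × ℝ) (show 0 < min 1 (l / (4 * A)) by positivity)
    filter_upwards [this] with y hy
    simpa using hy
  have hFb : ∀ y, |F y| ≤ ‖p m‖ * ‖y‖ ^ m := by
    intro y
    have := (p m).le_opNorm (fun _ => y)
    simpa [hF] using this
  refine ⟨m, l / 4, by positivity, ‖p m‖ + A, by positivity, min (a / 2) 1, by positivity, ?_⟩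
  filter_upwards [hrem, hsmall] with y hy hys
  have hy1 : ‖y‖ < 1 := hys.trans_le (min_le_left _ _)
  have hy2 : A * ‖y‖ ≤ l / 4 := by
    have : ‖y‖ ≤ l / (4 * A) := (hys.trans_le (min_le_right _ _)).le
    calc A * ‖y‖ ≤ A * (l / (4 * A)) := by gcongr
      _ = l / 4 := by field_simp
  constructor
  · have h1 : |f y| ≤ |f y - F y| + |F y| := by simpa using abs_add_le (f y - F y) (F y)
    have h2 : A * ‖y‖ ^ (m + 1) ≤ A * ‖y‖ ^ m := by
      gcongr A * ?_
      exact pow_le_pow_of_le_one (norm_nonneg _) hy1.le (Nat.le_succ m)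
    have := hFb y
    linarith
  · intro hcone
    have hy21 : |y.2| ≤ |y.1| := by
      refine hcone.trans ?_
      calc min (a / 2) 1 * |y.1| ≤ 1 * |y.1| := by gcongr; exact min_le_right _ _
        _ = |y.1| := one_mul _
    have hn : ‖y‖ = |y.1| := by
      rw [Prod.norm_def, Real.norm_eq_abs, Real.norm_eq_abs, max_eq_left hy21]
    have hFl : l / 2 * |y.1| ^ m ≤ |F y| := by
      by_cases h0 : y.1 = 0
      · have hy0 : y = (0 : ℝ) • ((1 : ℝ), (0 : ℝ)) := by
          rw [h0, abs_zero] at hy21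
          ext
          · simpa using h0
          · simpa using abs_nonpos_iff.1 hy21
        rw [hy0, hFhom, abs_mul, abs_pow]
        simp only [zero_smul, Prod.fst_zero]
        rw [mul_comm]
        gcongr
        linarith
      · have hy0 : y = y.1 • ((1 : ℝ), y.2 / y.1) := by
          ext
          · simp
          · simp [mul_div_cancel₀ _ h0]
        have hd : dist (y.2 / y.1) 0 < a := by
          rw [Real.dist_eq, sub_zero, abs_div, div_lt_iff₀ (abs_pos.2 h0)]
          refine hcone.trans_lt ?_
          have : min (a / 2) 1 < a := (min_le_left _ _).trans_lt (by linarith)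
          have := abs_pos.2 h0
          gcongr
        have h1 : F y = y.1 ^ m * F (1, y.2 / y.1) := by
          conv_lhs => rw [hy0]
          exact hFhom _ _
        rw [h1, abs_mul, abs_pow, mul_comm]
        gcongr
        exact (hba hd).le
    have h2 := abs_sub_abs_le_abs_sub (F y) (f y)
    rw [abs_sub_comm] at h2
    have h3 : A * ‖y‖ ^ (m + 1) ≤ l / 4 * |y.1| ^ m := by
      rw [pow_succ, hn]
      rw [hn] at hy2
      calc A * (|y.1| ^ m * |y.1|) = A * |y.1| * |y.1| ^ m := by ring
        _ ≤ l / 4 * |y.1| ^ m := by gcongr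
    linarith

theorem IsBiLipschitzGerm.exists_inverse {σ : ℝ × ℝ → ℝ × ℝ} (h : IsBiLipschitzGerm σ) :
    ∃ τ, IsBiLipschitzGerm τ ∧ ∀ᶠ q in 𝓝 (0 : ℝ × ℝ), σ (τ q) = q := by
  obtain ⟨h0, U, V, τ, K, hU, hV, h0U, h0V, hσ, hτ, hl, hr, hLσ, hLτ⟩ := h
  refine ⟨τ, ⟨?_, V, U, σ, K, hV, hU, h0V, h0U, hτ, hσ, hr, hl, hLτ, hLσ⟩, ?_⟩
  · have := hl 0 h0U
    rwa [h0] at this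
  · filter_upwards [hV.mem_nhds h0V] with q hq using hr q hq

theorem IsBiLipschitzGerm.exists_bounds {σ : ℝ × ℝ → ℝ × ℝ} (h : IsBiLipschitzGerm σ) :
    σ 0 = 0 ∧ ∃ K ≥ 1, ∃ r > 0, ∀ p q : ℝ × ℝ, ‖p‖ < r → ‖q‖ < r →
      ‖σ p - σ q‖ ≤ K * ‖p - q‖ ∧ ‖p - q‖ ≤ K * ‖σ p - σ q‖ := by
  obtain ⟨h0, U, V, τ, K, hU, hV, h0U, h0V, hσ, hτ, hl, hr, hLσ, hLτ⟩ := h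
  obtain ⟨r, hr0, hrU⟩ := Metric.mem_nhds_iff.1 (hU.mem_nhds h0U)
  refine ⟨h0, max 1 (K : ℝ), le_max_left _ _, r, hr0, fun p q hp hq => ?_⟩
  have hpU : p ∈ U := hrU (by simpa using hp)
  have hqU : q ∈ U := hrU (by simpa using hq)
  have h1 := hLσ.dist_le_mul p hpU q hqU
  have h2 := hLτ.dist_le_mul _ (hσ hpU) _ (hσ hqU)
  rw [hl p hpU, hl q hqU] at h2
  rw [dist_eq_norm, dist_eq_norm] at h1 h2
  have hK : (K : ℝ) ≤ max 1 (K : ℝ) := le_max_right _ _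
  exact ⟨h1.trans (by gcongr), h2.trans (by gcongr)⟩

theorem IsBiLipschitzGerm.tendsto {σ : ℝ × ℝ → ℝ × ℝ} (h : IsBiLipschitzGerm σ) :
    Tendsto σ (𝓝 0) (𝓝 0) := by
  obtain ⟨h0, K, hK, r, hr, hb⟩ := h.exists_bounds
  have h1 : Tendsto (fun p : ℝ × ℝ => K * ‖p‖) (𝓝 0) (𝓝 0) := by
    have : Continuous fun p : ℝ × ℝ => K * ‖p‖ := by fun_prop
    simpa using this.tendsto 0
  refine squeeze_zero_norm' ?_ h1
  filter_upwards [Metric.ball_mem_nhds (0 : ℝ × ℝ) hr] with p hp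
  simpa [h0] using (hb p 0 (by simpa using hp) (by simpa using hr)).1

/-- Bi-Lipschitz maps do not lower the order of vanishing. -/
theorem IsBiLipschitzGerm.order_le {σ : ℝ × ℝ → ℝ × ℝ} (hσ : IsBiLipschitzGerm σ)
    {f g : ℝ × ℝ → ℝ} (hfg : ∀ᶠ p in 𝓝 (0 : ℝ × ℝ), f p = g (σ p)) {m n : ℕ} {c C δ : ℝ}
    (hc : 0 < c) (hδ : 0 < δ)
    (hf : ∀ᶠ p in 𝓝 (0 : ℝ × ℝ), |p.2| ≤ δ * |p.1| → c * |p.1| ^ m ≤ |f p|)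
    (hC : 0 < C) (hg : ∀ᶠ p in 𝓝 (0 : ℝ × ℝ), |g p| ≤ C * ‖p‖ ^ n) : n ≤ m := by
  obtain ⟨h0, K, hK, r, hr, hb⟩ := hσ.exists_bounds
  have hline : Tendsto (fun t : ℝ => ((t, 0) : ℝ × ℝ)) (𝓝[>] 0) (𝓝 0) := by
    have : Continuous fun t : ℝ => ((t, 0) : ℝ × ℝ) := by fun_prop
    exact (this.tendsto 0).mono_left nhdsWithin_le_nhds
  have hA : 0 < C * K ^ n / c := by positivity
  have H : ∀ z ≥ (1 : ℝ), ∀ᶠ t in 𝓝[>] (0 : ℝ),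
      z ^ 0 * t ^ (m : ℝ) ≤ C * K ^ n / c * (z ^ 0 * t ^ (n : ℝ)) := by
    intro z _
    filter_upwards [hline.eventually hf, hline.eventually hfg,
      hline.eventually (hσ.tendsto.eventually hg),
      hline.eventually (Metric.ball_mem_nhds (0 : ℝ × ℝ) hr), self_mem_nhdsWithin]
      with t h1 h2 h3 h4 h5
    have h5 : 0 < t := h5
    have h6 := (hb (t, 0) 0 (by simpa using h4) (by simpa using hr)).1
    have hn : ‖((t, 0) : ℝ × ℝ)‖ = t := by
      rw [Prod.norm_def, norm_zero, Real.norm_eq_abs, abs_of_pos h5, max_eq_left h5.le]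
    rw [h0, sub_zero, sub_zero, hn] at h6
    have h7 := h1 (by simp only [abs_zero]; positivity)
    rw [h2] at h7
    simp only [abs_of_pos h5] at h7
    rw [pow_zero, one_mul, one_mul, Real.rpow_natCast, Real.rpow_natCast]
    have h8 : C * ‖σ (t, 0)‖ ^ n ≤ C * (K * t) ^ n := by gcongr
    rw [mul_pow] at h8
    rw [div_mul_eq_mul_div, le_div_iff₀ hc]
    linarith
  exact_mod_cast (exponents_le hA H).1

/-- At rate `1` the exponent and the degree are both equal to the order of vanishing. -/
theorem AdmitsExpansion.eq_order {f : ℝ × ℝ → ℝ} {lam : ℝ → ℝ} {e : ℝ} {P : ℝ[X]}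
    (h : AdmitsExpansion f lam 1 e P) (hP : P ≠ 0) (hlam : AllowableBranch lam)
    {m : ℕ} {c C δ : ℝ} (hc : 0 < c) (hC : 0 < C) (hδ : 0 < δ)
    (hf : ∀ᶠ p in 𝓝 (0 : ℝ × ℝ), |f p| ≤ C * ‖p‖ ^ m ∧
      (|p.2| ≤ δ * |p.1| → c * |p.1| ^ m ≤ |f p|)) :
    e = m ∧ P.natDegree = m := by
  obtain ⟨hlam0, η, hη, L, hL, hLip⟩ := hlam.exists_lipschitz
  obtain ⟨c', hc', C', hC', Z, hZ, hb⟩ := h.exists_bounds hP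
  set Z' := max (max Z (2 * L)) (2 / δ)
  have hZ1 : Z ≤ Z' := (le_max_left _ _).trans (le_max_left _ _)
  have hZ2 : 2 * L ≤ Z' := (le_max_right _ _).trans (le_max_left _ _)
  have hZ3 : 2 / δ ≤ Z' := le_max_right _ _
  have main : ∀ z ≥ Z', ∀ᶠ y in 𝓝[>] (0 : ℝ),
      c' * (z ^ P.natDegree * y ^ e) ≤ C * 2 ^ m * (z ^ m * y ^ (m : ℝ)) ∧
      c / 2 ^ m * (z ^ m * y ^ (m : ℝ)) ≤ C' * (z ^ P.natDegree * y ^ e) := by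
    intro z hz
    have hz1 : 1 ≤ z := hZ.trans (hZ1.trans hz)
    have hz0 : 0 < z := by linarith
    have hlim : Tendsto (fun y : ℝ => 2 * z * y) (𝓝[>] 0) (𝓝 0) := by
      have : Continuous fun y : ℝ => 2 * z * y := by fun_prop
      have := this.tendsto 0
      rw [mul_zero] at this
      exact this.mono_left nhdsWithin_le_nhds
    obtain ⟨ρ, hρ, hρf⟩ := Metric.eventually_nhds_iff.1 hf
    filter_upwards [hb z hz0, self_mem_nhdsWithin, Ioo_mem_nhdsGT hη,
      hlim.eventually_lt_const hρ] with y h1 hy0 hyη hyρ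
    have hy0 : 0 < y := hy0
    have habs : |z| = z := abs_of_pos hz0
    obtain ⟨h2, h3⟩ := h1 z (by rw [habs]; exact hZ1.trans hz) habs.le
    rw [habs, Real.rpow_one] at h2 h3
    have hly : |lam y| ≤ L * y := by
      have := hLip y ⟨hy0.le, hyη.2.le⟩ 0 ⟨le_rfl, hη.le⟩
      rwa [hlam0, sub_zero, sub_zero, abs_of_pos hy0] at this
    have hLz : L * y ≤ z * y / 2 := by nlinarith [hZ2.trans hz]
    obtain ⟨h4, h5⟩ := abs_le.1 hly
    have h6 : z * y / 2 ≤ lam y + z * y := by linarith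
    have hzy : 0 < z * y := by positivity
    have h7 : |lam y + z * y| = lam y + z * y := abs_of_nonneg (by linarith)
    have hyzy : y ≤ 2 * z * y := by nlinarith
    have hnorm : ‖((lam y + z * y, y) : ℝ × ℝ)‖ ≤ 2 * z * y := by
      rw [Prod.norm_def, Real.norm_eq_abs, Real.norm_eq_abs, h7, abs_of_pos hy0]
      exact max_le (by linarith) hyzy
    obtain ⟨h8, h9⟩ := hρf (y := (lam y + z * y, y))
      (by rw [dist_zero_right]; exact hnorm.trans_lt hyρ)
    have h10 := h9 (by
      simp only [h7, abs_of_pos hy0]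
      have : 2 / δ ≤ z := hZ3.trans hz
      rw [div_le_iff₀ hδ] at this
      nlinarith)
    simp only [h7] at h10
    rw [Real.rpow_natCast]
    constructor
    · calc c' * (z ^ P.natDegree * y ^ e) ≤ C * ‖((lam y + z * y, y) : ℝ × ℝ)‖ ^ m := h2.trans h8
        _ ≤ C * (2 * z * y) ^ m := by gcongr
        _ = C * 2 ^ m * (z ^ m * y ^ m) := by rw [mul_pow, mul_pow]; ring
    · calc c / 2 ^ m * (z ^ m * y ^ m) = c * (z * y / 2) ^ m := by
            rw [div_pow, mul_pow]; ring
        _ ≤ c * (lam y + z * y) ^ m := by gcongr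
        _ ≤ C' * (z ^ P.natDegree * y ^ e) := h10.trans h3
  exact exponents_eq hc' (by positivity) (by positivity) hC' main

/-- Uniform estimates along a branch `γ` carried by a bi-Lipschitz map into a horn around another branch. -/
theorem exists_branch_bounds {σ : ℝ × ℝ → ℝ × ℝ} (hσ0 : σ 0 = 0) {K r : ℝ} (hK : 1 ≤ K)
    (hr : 0 < r) (hb : ∀ p q : ℝ × ℝ, ‖p‖ < r → ‖q‖ < r →
      ‖σ p - σ q‖ ≤ K * ‖p - q‖ ∧ ‖p - q‖ ≤ K * ‖σ p - σ q‖)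
    {lam lam' : ℝ → ℝ} (hγ : AllowableBranch lam) (hγ' : AllowableBranch lam')
    {ξ₀ N ξ : ℝ} (hN : 0 < N)
    (hincl : ∀ᶠ y in 𝓝[>] (0 : ℝ), σ (lam y, y) ∈ Horn ξ₀ lam' N)
    (hξ : 1 < ξ) (hξξ₀ : ξ ≤ ξ₀) :
    ∃ L ≥ 1, ∃ B ≥ 1, ∃ a > 0, (L + 1) * a < r ∧
      (∀ s ∈ Set.Icc 0 a, ∀ t ∈ Set.Icc 0 a, |lam s - lam t| ≤ L * |s - t|) ∧
      (∀ s ∈ Set.Icc 0 (2 * B * a), ∀ t ∈ Set.Icc 0 (2 * B * a),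
        |lam' s - lam' t| ≤ L * |s - t|) ∧
      (∀ y ∈ Set.Icc 0 a, ‖((lam y, y) : ℝ × ℝ)‖ ≤ L * y) ∧
      (∀ y ∈ Set.Ioc 0 a, 0 < (σ (lam y, y)).2 ∧
        |(σ (lam y, y)).1 - lam' (σ (lam y, y)).2| ≤ N * (σ (lam y, y)).2 ^ ξ ∧
        (σ (lam y, y)).2 ≤ B * y ∧ y ≤ B * (σ (lam y, y)).2) ∧
      ∀ v ∈ Set.Ioc 0 (a / B), ∃ y ∈ Set.Ioc 0 a, (σ (lam y, y)).2 = v := by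
  obtain ⟨hlam0, δ₁, hδ₁, L₁, hL₁, hLip₁⟩ := hγ.exists_lipschitz
  obtain ⟨hlam0', δ₂, hδ₂, L₂, hL₂, hLip₂⟩ := hγ'.exists_lipschitz
  obtain ⟨η, hη, hηH⟩ := mem_nhdsGT_iff_exists_Ioo_subset.1 hincl
  have hη : 0 < η := hη
  set L := max 1 (max L₁ L₂)
  have hL1 : 1 ≤ L := le_max_left _ _
  have hLL₁ : L₁ ≤ L := (le_max_left _ _).trans (le_max_right _ _)
  have hLL₂ : L₂ ≤ L := (le_max_right _ _).trans (le_max_right _ _)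
  set B := K * (L + N) + K * L with hB
  have hKL : 1 ≤ K * L := by nlinarith
  have hB1 : 1 ≤ B := by nlinarith [mul_pos (show 0 < K by linarith) hN]
  have hKLB : K * L ≤ B := by nlinarith [mul_pos (show 0 < K by linarith) hN]
  have hKLNB : K * (L + N) ≤ B := by linarith
  -- All points considered below have height at most `a`, or at most twice `B * a` after applying `σ`.
  obtain ⟨a, ha, haδ₁, haη, hab, har⟩ : ∃ a > 0, a ≤ δ₁ ∧ a < η ∧
      2 * B * a ≤ min 1 δ₂ ∧ (L + 1) * a < r := by
    refine ⟨min (min δ₁ (η / 2)) (min (min 1 δ₂ / (2 * B)) (r / (2 * (L + 1)))),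
      by positivity, ?_, ?_, ?_, ?_⟩
    · exact (min_le_left _ _).trans (min_le_left _ _)
    · exact ((min_le_left _ _).trans (min_le_right _ _)).trans_lt (by linarith)
    · rw [mul_comm, ← le_div_iff₀ (by positivity)]
      exact (min_le_right _ _).trans (min_le_left _ _)
    · rw [mul_comm, ← lt_div_iff₀ (by positivity)]
      refine ((min_le_right _ _).trans (min_le_right _ _)).trans_lt ?_
      gcongr
      linarith
  have hlip : ∀ s ∈ Set.Icc 0 a, ∀ t ∈ Set.Icc 0 a, |lam s - lam t| ≤ L * |s - t| :=
    fun s hs t ht => (hLip₁ s ⟨hs.1, hs.2.trans haδ₁⟩ t ⟨ht.1, ht.2.trans haδ₁⟩).trans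
      (by gcongr)
  have hlip' : ∀ s ∈ Set.Icc 0 (2 * B * a), ∀ t ∈ Set.Icc 0 (2 * B * a),
      |lam' s - lam' t| ≤ L * |s - t| := by
    have : 2 * B * a ≤ δ₂ := hab.trans (min_le_right _ _)
    exact fun s hs t ht => (hLip₂ s ⟨hs.1, hs.2.trans this⟩ t ⟨ht.1, ht.2.trans this⟩).trans
      (by gcongr)
  have hba1 : 2 * B * a ≤ 1 := hab.trans (min_le_left _ _)
  have hnorm : ∀ y ∈ Set.Icc 0 a, ‖((lam y, y) : ℝ × ℝ)‖ ≤ L * y := by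
    intro y hy
    have h1 := hlip y hy 0 ⟨le_rfl, ha.le⟩
    rw [hlam0, sub_zero, sub_zero, abs_of_nonneg hy.1] at h1
    rw [Prod.norm_def, Real.norm_eq_abs, Real.norm_eq_abs, abs_of_nonneg hy.1]
    exact max_le h1 (by nlinarith [hy.1])
  have hnormr : ∀ y ∈ Set.Icc 0 a, ‖((lam y, y) : ℝ × ℝ)‖ < r := by
    intro y hy
    refine (hnorm y hy).trans_lt ?_
    nlinarith [hy.1, hy.2]
  have hHorn : ∀ y ∈ Set.Ioc 0 a, 0 < (σ (lam y, y)).2 ∧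
      |(σ (lam y, y)).1 - lam' (σ (lam y, y)).2| ≤ N * (σ (lam y, y)).2 ^ ξ := by
    intro y hy
    obtain ⟨h1, h2⟩ : σ (lam y, y) ∈ Horn ξ₀ lam' N := hηH ⟨hy.1, hy.2.trans_lt haη⟩
    refine ⟨h1, h2.trans ?_⟩
    have h3 := (hb (lam y, y) 0 (hnormr y ⟨hy.1.le, hy.2⟩) (by simpa using hr)).1
    rw [hσ0, sub_zero, sub_zero] at h3
    have h4 := hnorm y ⟨hy.1.le, hy.2⟩
    have h5 : (σ (lam y, y)).2 ≤ 1 := by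
      calc (σ (lam y, y)).2 ≤ ‖σ (lam y, y)‖ :=
            (le_abs_self _).trans (norm_snd_le (σ (lam y, y)))
        _ ≤ K * (L * y) := h3.trans (by gcongr)
        _ = K * L * y := by ring
        _ ≤ B * a := mul_le_mul hKLB hy.2 hy.1.le (by linarith)
        _ ≤ 1 := by nlinarith
    gcongr N * ?_
    exact Real.rpow_le_rpow_of_exponent_ge h1 h5 hξξ₀
  have hup : ∀ y ∈ Set.Ioc 0 a, (σ (lam y, y)).2 ≤ B * y := by
    intro y hy
    have h3 := (hb (lam y, y) 0 (hnormr y ⟨hy.1.le, hy.2⟩) (by simpa using hr)).1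
    rw [hσ0, sub_zero, sub_zero] at h3
    have h4 := hnorm y ⟨hy.1.le, hy.2⟩
    calc (σ (lam y, y)).2 ≤ ‖σ (lam y, y)‖ := (le_abs_self _).trans (norm_snd_le (σ (lam y, y)))
      _ ≤ K * (L * y) := h3.trans (by gcongr)
      _ = K * L * y := by ring
      _ ≤ B * y := by have := hy.1; gcongr
  have hlow : ∀ y ∈ Set.Ioc 0 a, y ≤ B * (σ (lam y, y)).2 := by
    intro y hy
    obtain ⟨h1, h2⟩ := hHorn y hy
    have h3 := (hb (lam y, y) 0 (hnormr y ⟨hy.1.le, hy.2⟩) (by simpa using hr)).2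
    rw [hσ0, sub_zero, sub_zero] at h3
    have h4 := hup y hy
    have h5 : B * y ≤ 2 * B * a := by nlinarith [hy.2]
    have h6 := hlip' (σ (lam y, y)).2 ⟨h1.le, h4.trans h5⟩ 0 ⟨le_rfl, by positivity⟩
    rw [hlam0', sub_zero, sub_zero, abs_of_pos h1] at h6
    have h7 : (σ (lam y, y)).2 ^ ξ ≤ (σ (lam y, y)).2 := by
      conv_rhs => rw [← Real.rpow_one (σ (lam y, y)).2]
      exact Real.rpow_le_rpow_of_exponent_ge h1 ((h4.trans h5).trans hba1) hξ.le
    have h8 : ‖σ (lam y, y)‖ ≤ (L + N) * (σ (lam y, y)).2 := by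
      rw [Prod.norm_def, Real.norm_eq_abs, Real.norm_eq_abs, abs_of_pos h1]
      refine max_le ?_ (by nlinarith)
      have h9 : |(σ (lam y, y)).1| ≤
          |(σ (lam y, y)).1 - lam' (σ (lam y, y)).2| + |lam' (σ (lam y, y)).2| := by
        simpa using abs_add_le ((σ (lam y, y)).1 - lam' (σ (lam y, y)).2)
          (lam' (σ (lam y, y)).2)
      nlinarith
    calc y ≤ ‖((lam y, y) : ℝ × ℝ)‖ := (le_abs_self _).trans (norm_snd_le (lam y, y))
      _ ≤ K * ((L + N) * (σ (lam y, y)).2) := h3.trans (by gcongr)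
      _ = K * (L + N) * (σ (lam y, y)).2 := by ring
      _ ≤ B * (σ (lam y, y)).2 := by gcongr
  have hcont : ContinuousOn (fun y => (σ (lam y, y)).2) (Set.Icc 0 a) := by
    refine (LipschitzOnWith.of_dist_le_mul (K := (K * L).toNNReal) ?_).continuousOn
    intro s hs t ht
    rw [Real.coe_toNNReal _ (by linarith), Real.dist_eq, Real.dist_eq]
    have h1 := (hb (lam s, s) (lam t, t) (hnormr s hs) (hnormr t ht)).1
    have h2 : ‖((lam s, s) : ℝ × ℝ) - (lam t, t)‖ ≤ L * |s - t| := by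
      rw [Prod.mk_sub_mk, Prod.norm_def, Real.norm_eq_abs, Real.norm_eq_abs]
      exact max_le (hlip s hs t ht) (by nlinarith [abs_nonneg (s - t)])
    calc |(σ (lam s, s)).2 - (σ (lam t, t)).2| ≤ ‖σ (lam s, s) - σ (lam t, t)‖ :=
          norm_snd_le (σ (lam s, s) - σ (lam t, t))
      _ ≤ K * (L * |s - t|) := h1.trans (by gcongr)
      _ = K * L * |s - t| := by ring
  have hzero : (σ (lam 0, 0)).2 = 0 := by
    rw [hlam0]
    change (σ 0).2 = 0
    rw [hσ0]; rfl
  refine ⟨L, hL1, B, hB1, a, ha, har, hlip, hlip', hnorm, fun y hy =>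
    ⟨(hHorn y hy).1, (hHorn y hy).2, hup y hy, hlow y hy⟩, fun v hv => ?_⟩
  have h1 : v ∈ Set.Icc (σ (lam 0, 0)).2 (σ (lam a, a)).2 := by
    refine ⟨by rw [hzero]; exact hv.1.le, hv.2.trans ?_⟩
    rw [div_le_iff₀ (by linarith), mul_comm]
    exact hlow a ⟨ha, le_rfl⟩
  obtain ⟨y, hy, hyv⟩ := intermediate_value_Icc ha.le hcont h1
  refine ⟨y, ⟨hy.1.lt_of_ne ?_, hy.2⟩, hyv⟩
  rintro rfl
  exact hv.1.ne (hzero.symm.trans hyv)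

/-- A bi-Lipschitz germ carrying a branch into a horn around another one distorts the coordinate
`z` of the points `(λ(y) + z y ^ ξ, y)` by a bounded factor when `ξ > 1` and `z` is large. -/
theorem IsBiLipschitzGerm.exists_horn_bounds {σ : ℝ × ℝ → ℝ × ℝ} (hσ : IsBiLipschitzGerm σ)
    {lam lam' : ℝ → ℝ} (hγ : AllowableBranch lam) (hγ' : AllowableBranch lam')
    {ξ₀ N ξ : ℝ} (hN : 0 < N)
    (hincl : ∀ᶠ y in 𝓝[>] (0 : ℝ), σ (lam y, y) ∈ Horn ξ₀ lam' N)
    (hξ : 1 < ξ) (hξξ₀ : ξ ≤ ξ₀) :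
    ∃ M ≥ 1, ∃ Z ≥ 1, ∀ z ≥ Z, ∀ᶠ y in 𝓝[>] (0 : ℝ), ∃ w y' : ℝ,
      σ (lam y + z * y ^ ξ, y) = (lam' y' + w * y' ^ ξ, y') ∧
      y ≤ M * y' ∧ y' ≤ M * y ∧ z ≤ M * |w| ∧ |w| ≤ M * z := by
  obtain ⟨hσ0, K, hK, r, hr, hb⟩ := hσ.exists_bounds
  obtain ⟨L, hL1, B, hB1, a, ha, har, hlip, hlip', hnorm, hγσ, hsurj⟩ :=
    exists_branch_bounds hσ0 hK hr hb hγ hγ' hN hincl hξ hξξ₀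
  have hnormr : ∀ y ∈ Set.Icc 0 a, ‖((lam y, y) : ℝ × ℝ)‖ < r := by
    intro y hy
    refine (hnorm y hy).trans_lt ?_
    nlinarith [hy.1, hy.2]
  set S := (2 * B) ^ ξ with hS
  have hS1 : 1 ≤ S := Real.one_le_rpow (by linarith) (by linarith)
  set M := max (2 * B) (max (2 * S * ((1 + L) * K)) ((K + N * S + L * K) * S))
  have hM1 : 2 * B ≤ M := le_max_left _ _
  have hM2 : 2 * S * ((1 + L) * K) ≤ M := (le_max_left _ _).trans (le_max_right _ _)
  have hM3 : (K + N * S + L * K) * S ≤ M := (le_max_right _ _).trans (le_max_right _ _)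
  refine ⟨M, by linarith, max 1 (2 * S * ((1 + L) * K) * N), le_max_left _ _, fun z hz => ?_⟩
  have hz1 : 1 ≤ z := (le_max_left _ _).trans hz
  have hzN : 2 * S * ((1 + L) * K) * N ≤ z := (le_max_right _ _).trans hz
  have hev := eventually_rpow_le hξ (show 0 < 1 / (2 * B * K * z) by positivity)
  have ha2 : 0 < a / (2 * B ^ 2) := by positivity
  filter_upwards [hev, Ioo_mem_nhdsGT ha, Ioo_mem_nhdsGT ha2] with y hy hya hya2
  obtain ⟨hy0, hya⟩ := hya
  rw [Real.rpow_one] at hy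
  have hyI : y ∈ Set.Ioc 0 a := ⟨hy0, hya.le⟩
  have hyξ : 0 < y ^ ξ := Real.rpow_pos_of_pos hy0 ξ
  have hzy : 0 < z * y ^ ξ := by positivity
  have hKz : K * (z * y ^ ξ) ≤ y / (2 * B) := by
    calc K * (z * y ^ ξ) ≤ K * (z * (1 / (2 * B * K * z) * y)) := by gcongr
      _ = y / (2 * B) := by field_simp
  have hzyy : z * y ^ ξ ≤ y := by
    have h1 : z * y ^ ξ ≤ K * (z * y ^ ξ) := le_mul_of_one_le_left hzy.le hK
    have h2 : y / (2 * B) ≤ y := div_le_self hy0.le (by linarith)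
    linarith
  set p : ℝ × ℝ := (lam y, y) with hp
  set p' : ℝ × ℝ := (lam y + z * y ^ ξ, y) with hp'
  have hpp' : p' - p = (z * y ^ ξ, 0) := by rw [hp, hp', Prod.mk_sub_mk]; simp
  have hnpp' : ‖p' - p‖ = z * y ^ ξ := by
    rw [hpp', Prod.norm_def, norm_zero, Real.norm_eq_abs, abs_of_pos hzy, max_eq_left hzy.le]
  have hp'r : ‖p'‖ < r := by
    have h1 : ‖p'‖ ≤ ‖p' - p‖ + ‖p‖ := by simpa using norm_add_le (p' - p) p
    have h2 := hnorm y ⟨hy0.le, hya.le⟩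
    have h3 : (L + 1) * y ≤ (L + 1) * a := by gcongr
    rw [hnpp'] at h1
    linarith
  have hσpp' : ‖σ p' - σ p‖ ≤ K * (z * y ^ ξ) := by
    rw [← hnpp']
    exact (hb p' p hp'r (hnormr y ⟨hy0.le, hya.le⟩)).1
  have hfst : |(σ p').1 - (σ p).1| ≤ K * (z * y ^ ξ) := (norm_fst_le (σ p' - σ p)).trans hσpp'
  have hsnd : |(σ p').2 - (σ p).2| ≤ K * (z * y ^ ξ) := (norm_snd_le (σ p' - σ p)).trans hσpp'
  obtain ⟨hh0, hhorn, hhup, hhlow⟩ := hγσ y hyI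
  rw [← hp] at hh0 hhorn hhup hhlow
  obtain ⟨hs1, hs2⟩ := abs_le.1 hsnd
  set y' := (σ p').2 with hy'
  have hBpos : 0 < B := by linarith
  have hyB : y / B ≤ (σ p).2 := by rw [div_le_iff₀ hBpos]; linarith
  have hyB2 : y / B = y / (2 * B) + y / (2 * B) := by field_simp; norm_num
  have hy'low : y ≤ 2 * B * y' := by
    have : y / (2 * B) ≤ y' := by linarith
    rw [div_le_iff₀ (by positivity)] at this
    linarith
  have hy'up : y' ≤ 2 * B * y := by
    have : y / (2 * B) ≤ y := div_le_self hy0.le (by linarith)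
    have := le_mul_of_one_le_left hy0.le hB1
    linarith
  have hy'0 : 0 < y' := by
    by_contra! hneg
    have := mul_nonpos_of_nonneg_of_nonpos (show 0 ≤ 2 * B by positivity) hneg
    linarith
  have hy'a : y' ≤ 2 * B * a := hy'up.trans (by gcongr)
  have hy'ξ : 0 < y' ^ ξ := Real.rpow_pos_of_pos hy'0 ξ
  have hSy : y ^ ξ ≤ S * y' ^ ξ := by
    rw [hS, ← Real.mul_rpow (by positivity) hy'0.le]
    exact Real.rpow_le_rpow hy0.le hy'low (by linarith)
  have hSh : (σ p).2 ^ ξ ≤ S * y ^ ξ := by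
    rw [hS, ← Real.mul_rpow (by positivity) hy0.le]
    exact Real.rpow_le_rpow hh0.le (by linarith [mul_pos hBpos hy0]) (by linarith)
  -- a point of the branch whose image has the prescribed height
  obtain ⟨y₁, hy₁J, hy₁⟩ := hsurj y' ⟨hy'0, by
    have h3 := hya2.2
    rw [lt_div_iff₀ (by positivity)] at h3
    rw [le_div_iff₀ hBpos]
    linarith [mul_le_mul_of_nonneg_right hy'up hBpos.le]⟩
  have hy₁I : y₁ ∈ Set.Icc 0 a := ⟨hy₁J.1.le, hy₁J.2⟩
  obtain ⟨-, hhorn₁, -, -⟩ := hγσ y₁ hy₁J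
  rw [hy₁] at hhorn₁
  set p₁ : ℝ × ℝ := (lam y₁, y₁) with hp₁
  set D := |(σ p').1 - lam' y'| with hD
  have hlower : z * y ^ ξ ≤ (1 + L) * K * (D + N * y' ^ ξ) := by
    have h1 := (hb p' p₁ hp'r (hnormr y₁ hy₁I)).2
    have h2 : ‖σ p' - σ p₁‖ ≤ D + N * y' ^ ξ := by
      rw [Prod.norm_def, Prod.fst_sub, Prod.snd_sub, hy₁, ← hy', sub_self, norm_zero,
        Real.norm_eq_abs, max_eq_left (abs_nonneg _)]
      have := abs_sub_le (σ p').1 (lam' y') (σ p₁).1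
      rw [abs_sub_comm (lam' y')] at this
      linarith
    have h3 : |y - y₁| ≤ ‖p' - p₁‖ := norm_snd_le (p' - p₁)
    have h4 : |lam y + z * y ^ ξ - lam y₁| ≤ ‖p' - p₁‖ := norm_fst_le (p' - p₁)
    have h5 := hlip y ⟨hy0.le, hya.le⟩ y₁ hy₁I
    have h6 : z * y ^ ξ ≤ |lam y + z * y ^ ξ - lam y₁| + |lam y - lam y₁| := by
      have h7 := le_abs_self (lam y + z * y ^ ξ - lam y₁)
      have h8 := neg_abs_le (lam y - lam y₁)
      have h9 := le_abs_self (lam y - lam y₁)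
      linarith
    calc z * y ^ ξ ≤ (1 + L) * ‖p' - p₁‖ := by
          linarith [mul_le_mul_of_nonneg_left h3 (show 0 ≤ L by linarith)]
      _ ≤ (1 + L) * (K * (D + N * y' ^ ξ)) := by
        gcongr
        exact h1.trans (by gcongr)
      _ = (1 + L) * K * (D + N * y' ^ ξ) := by ring
  have hupper : D ≤ (K + N * S + L * K) * S * z * y' ^ ξ := by
    have h1 := abs_sub_le (σ p').1 (σ p).1 (lam' y')
    have h2 := abs_sub_le (σ p).1 (lam' (σ p).2) (lam' y')
    have h3 := hlip' (σ p).2 ⟨hh0.le, by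
      linarith [mul_le_mul_of_nonneg_left hya.le hBpos.le, mul_pos hBpos ha]⟩ y' ⟨hy'0.le, hy'a⟩
    rw [abs_sub_comm (σ p).2] at h3
    have h4 : N * (σ p).2 ^ ξ ≤ N * (S * y ^ ξ) := by gcongr
    have h5 : L * |y' - (σ p).2| ≤ L * (K * (z * y ^ ξ)) := by gcongr
    have h6 : N * (S * y ^ ξ) ≤ N * (S * (z * y ^ ξ)) := by
      gcongr
      exact le_mul_of_one_le_left hyξ.le hz1
    calc D ≤ (K + N * S + L * K) * (z * y ^ ξ) := by linarith
      _ ≤ (K + N * S + L * K) * (z * (S * y' ^ ξ)) := by gcongr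
      _ = (K + N * S + L * K) * S * z * y' ^ ξ := by ring
  set w := ((σ p').1 - lam' y') / y' ^ ξ with hw
  have hwabs : |w| = D / y' ^ ξ := by rw [hw, abs_div, abs_of_pos hy'ξ]
  have hDw : D = |w| * y' ^ ξ := by rw [hwabs]; field_simp
  refine ⟨w, y', ?_, ?_, ?_, ?_, ?_⟩
  · refine Prod.ext ?_ rfl
    simp only [hw]
    field_simp
    ring
  · exact hy'low.trans (by gcongr)
  · exact hy'up.trans (by gcongr)
  · have h1 : y' ^ ξ ≤ S * y ^ ξ := by
      rw [hS, ← Real.mul_rpow (by positivity) hy0.le]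
      exact Real.rpow_le_rpow hy'0.le hy'up (by linarith)
    have h2 : z * y ^ ξ ≤ (1 + L) * K * ((|w| + N) * S) * y ^ ξ := by
      rw [hDw] at hlower
      calc z * y ^ ξ ≤ (1 + L) * K * (|w| * y' ^ ξ + N * y' ^ ξ) := hlower
        _ = (1 + L) * K * (|w| + N) * y' ^ ξ := by ring
        _ ≤ (1 + L) * K * (|w| + N) * (S * y ^ ξ) := by gcongr
        _ = _ := by ring
    have h3 := le_of_mul_le_mul_right h2 hyξ
    have h4 : z ≤ 2 * S * ((1 + L) * K) * |w| := by linarith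
    exact h4.trans (by gcongr)
  · rw [hwabs, div_le_iff₀ hy'ξ]
    refine hupper.trans ?_
    gcongr

theorem rpow_le_of_le_mul {M a b : ℝ} (hM : 1 ≤ M) (ha : 0 < a) (hb : 0 < b)
    (hab : a ≤ M * b) (hba : b ≤ M * a) (e : ℝ) : a ^ e ≤ M ^ |e| * b ^ e := by
  have hM0 : 0 < M := by linarith
  rcases le_total 0 e with he | he
  · rw [abs_of_nonneg he, ← Real.mul_rpow hM0.le hb.le]
    exact Real.rpow_le_rpow ha.le hab he
  · rw [abs_of_nonpos he, Real.rpow_neg hM0.le, ← Real.inv_rpow hM0.le,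
      ← Real.mul_rpow (by positivity) hb.le]
    refine Real.rpow_le_rpow_of_nonpos (by positivity) ?_ he
    rwa [inv_mul_le_iff₀ hM0]

theorem AllowableBranch.tendsto_add_mul_rpow {lam : ℝ → ℝ} (h : AllowableBranch lam)
    (z : ℝ) {ξ : ℝ} (hξ : 1 < ξ) :
    Tendsto (fun y => ((lam y + z * y ^ ξ, y) : ℝ × ℝ)) (𝓝[>] 0) (𝓝 0) := by
  obtain ⟨hlam0, δ, hδ, L, hL, hLip⟩ := h.exists_lipschitz
  have hid : Tendsto (fun y : ℝ => y) (𝓝[>] 0) (𝓝 0) := nhdsWithin_le_nhds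
  have hlam : Tendsto lam (𝓝[>] 0) (𝓝 0) := by
    have hLy : Tendsto (fun y : ℝ => L * y) (𝓝[>] 0) (𝓝 0) := by
      simpa using hid.const_mul L
    refine squeeze_zero_norm' ?_ hLy
    filter_upwards [Ioo_mem_nhdsGT hδ] with y hy
    have := hLip y ⟨hy.1.le, hy.2.le⟩ 0 ⟨le_rfl, hδ.le⟩
    rwa [hlam0, sub_zero, sub_zero, abs_of_pos hy.1] at this
  have hpow : Tendsto (fun y : ℝ => y ^ ξ) (𝓝[>] 0) (𝓝 0) := by
    have := (Real.continuousAt_rpow_const 0 ξ (Or.inr (by linarith))).tendsto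
    rw [Real.zero_rpow (by linarith)] at this
    exact this.mono_left nhdsWithin_le_nhds
  have h1 := hlam.add (hpow.const_mul z)
  rw [mul_zero, add_zero] at h1
  exact h1.prodMk_nhds hid

/-- Bi-Lipschitz invariance of the order function and of the degree of the coefficient
polynomial, under a horn inclusion hypothesis. -/
theorem stmt4 (σ : ℝ × ℝ → ℝ × ℝ) (hσ : IsBiLipschitzGerm σ)
    (f g : ℝ × ℝ → ℝ) (hfa : AnalyticAt ℝ f 0) (hga : AnalyticAt ℝ g 0)
    (hf0 : f 0 = 0) (hg0 : g 0 = 0)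
    (hfm : MiniRegularInX f) (hgm : MiniRegularInX g)
    (hfg : ∀ᶠ p in 𝓝 (0 : ℝ × ℝ), f p = g (σ p))
    (lam lam' : ℝ → ℝ) (hγ : AllowableBranch lam) (hγ' : AllowableBranch lam')
    (ξ₀ N : ℝ) (hξ₀ : 1 ≤ ξ₀) (hN : 0 < N)
    (hincl : ∀ᶠ y in 𝓝[>] (0 : ℝ), σ (lam y, y) ∈ Horn ξ₀ lam' N)
    (ξ : ℝ) (hξ1 : 1 ≤ ξ) (hξ2 : ξ ≤ ξ₀)
    (e e' : ℝ) (P Q : Polynomial ℝ) (hP : P ≠ 0) (hQ : Q ≠ 0)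
    (hPexp : AdmitsExpansion f lam ξ e P) (hQexp : AdmitsExpansion g lam' ξ e' Q) :
    e = e' ∧ P.degree = Q.degree := by
  rw [degree_eq_natDegree hP, degree_eq_natDegree hQ, Nat.cast_inj]
  rcases hξ1.eq_or_lt with rfl | hξ
  · obtain ⟨m, c, hc, C, hC, δ, hδ, hf⟩ := hfm.exists_bounds hfa
    obtain ⟨n, c', hc', C', hC', δ', hδ', hg⟩ := hgm.exists_bounds hga
    obtain ⟨τ, hτ, hστ⟩ := hσ.exists_inverse
    have hgf : ∀ᶠ q in 𝓝 (0 : ℝ × ℝ), g q = f (τ q) := by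
      filter_upwards [hστ, hτ.tendsto.eventually hfg] with q h1 h2
      rw [h2, h1]
    have hmn : m = n := le_antisymm
      (hτ.order_le hgf hc' hδ' (hg.mono fun _ h => h.2) hC (hf.mono fun _ h => h.1))
      (hσ.order_le hfg hc hδ (hf.mono fun _ h => h.2) hC' (hg.mono fun _ h => h.1))
    obtain ⟨h1, h2⟩ := hPexp.eq_order hP hγ hc hC hδ hf
    obtain ⟨h3, h4⟩ := hQexp.eq_order hQ hγ' hc' hC' hδ' hg
    rw [h1, h2, h3, h4, hmn]
    exact ⟨rfl, rfl⟩
  · obtain ⟨c, hc, C, hC, Z₁, hZ₁, hPb⟩ := hPexp.exists_bounds hP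
    obtain ⟨c', hc', C', hC', Z₂, hZ₂, hQb⟩ := hQexp.exists_bounds hQ
    obtain ⟨M, hM, Z, hZ, hσb⟩ := hσ.exists_horn_bounds hγ hγ' hN hincl hξ hξ2
    set T := M ^ Q.natDegree * M ^ |e'|
    have hT : 0 < T := by positivity
    refine exponents_eq (c := c) (C := C' * T) (c' := c') (C' := C * T)
      (Z := max Z (max Z₁ (M * Z₂))) hc (by positivity) hc' (by positivity) fun z hz => ?_
    have hzZ : Z ≤ z := (le_max_left _ _).trans hz
    have hzZ₁ : Z₁ ≤ z := ((le_max_left _ _).trans (le_max_right _ _)).trans hz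
    have hzZ₂ : M * Z₂ ≤ z := ((le_max_right _ _).trans (le_max_right _ _)).trans hz
    have hz0 : 0 < z := by linarith
    have habs : |z| = z := abs_of_pos hz0
    obtain ⟨η, hη, hηQ⟩ := mem_nhdsGT_iff_exists_Ioo_subset.1 (hQb (M * z) (by positivity))
    have hη : 0 < η / M := div_pos hη (by linarith)
    filter_upwards [hσb z hzZ, hPb z hz0, Ioo_mem_nhdsGT hη,
      (hγ.tendsto_add_mul_rpow z hξ).eventually hfg] with y hy hPy hyη hfgy
    obtain ⟨w, y', hw, h1, h2, h3, h4⟩ := hy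
    have hy0 : 0 < y := hyη.1
    have hy'0 : 0 < y' := by
      by_contra! hneg
      nlinarith
    have hy'η : y' < η := by
      have := hyη.2
      rw [lt_div_iff₀ (by linarith)] at this
      linarith
    have hwZ : Z₂ ≤ |w| := le_of_mul_le_mul_left (hzZ₂.trans h3) (by linarith)
    obtain ⟨h5, h6⟩ := hPy z (by rwa [habs]) habs.le
    obtain ⟨h7, h8⟩ := hηQ ⟨hy'0, hy'η⟩ w hwZ h4
    rw [hfgy, hw, habs] at h5 h6
    have h9 : |w| ^ Q.natDegree * y' ^ e' ≤ T * (z ^ Q.natDegree * y ^ e') := by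
      calc |w| ^ Q.natDegree * y' ^ e' ≤ (M * z) ^ Q.natDegree * (M ^ |e'| * y ^ e') := by
            gcongr
            exact rpow_le_of_le_mul hM hy'0 hy0 h2 h1 e'
        _ = T * (z ^ Q.natDegree * y ^ e') := by rw [mul_pow]; ring
    have h10 : z ^ Q.natDegree * y ^ e' ≤ T * (|w| ^ Q.natDegree * y' ^ e') := by
      calc z ^ Q.natDegree * y ^ e' ≤ (M * |w|) ^ Q.natDegree * (M ^ |e'| * y' ^ e') := by
            gcongr
            exact rpow_le_of_le_mul hM hy0 hy'0 h1 h2 e'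
        _ = T * (|w| ^ Q.natDegree * y' ^ e') := by rw [mul_pow]; ring
    constructor
    · calc c * (z ^ P.natDegree * y ^ e) ≤ C' * (|w| ^ Q.natDegree * y' ^ e') := h5.trans h8
        _ ≤ C' * (T * (z ^ Q.natDegree * y ^ e')) := by gcongr
        _ = C' * T * (z ^ Q.natDegree * y ^ e') := by ring
    · calc c' * (z ^ Q.natDegree * y ^ e') ≤ c' * (T * (|w| ^ Q.natDegree * y' ^ e')) := by gcongr
        _ = T * (c' * (|w| ^ Q.natDegree * y' ^ e')) := by ring
        _ ≤ T * (C * (z ^ P.natDegree * y ^ e)) := mul_le_mul_of_nonneg_left (h7.trans h6) hT.le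
        _ = C * T * (z ^ P.natDegree * y ^ e) := by ring
end
end

section
/- Let σ : (ℝ²,0) → (ℝ²,0) be a C¹ diffeomorphism germ and let f, g : (ℝ²,0) → (ℝ,0) be real analytic germs, not identically zero, mini-regular in x, with f = g ∘ σ on a neighbourhood of the origin. Let γ : x = λ(y) and γ̃ : x = λ̃(y) be allowable real analytic demi-branches such that f(λ(y), y) = 0 and g(λ̃(y), y) = 0 for all small y ≥ 0 (γ and γ̃ are Newton–Puiseux roots of f and g), and such that σ(γ) = γ̃ as set germs at the origin. Then the Puiseux characteristic exponents of λ and of λ̃ coincide. Moreover, if det Dσ(0) > 0, then for each common characteristic exponent α, the coefficients of y^α in the Puiseux expansions of λ and of λ̃ have the same sign. -/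
open Filter Topology

noncomputable section

/-- A C¹ diffeomorphism germ at the origin. -/
def IsC1DiffeoGerm {E : Type*} [NormedAddCommGroup E] [NormedSpace ℝ E] (σ : E → E) : Prop :=
  σ 0 = 0 ∧ ∃ (U V : Set E) (τ : E → E), IsOpen U ∧ IsOpen V ∧ (0 : E) ∈ U ∧ (0 : E) ∈ V ∧
    Set.MapsTo σ U V ∧ Set.MapsTo τ V U ∧ (∀ x ∈ U, τ (σ x) = x) ∧ (∀ y ∈ V, σ (τ y) = y) ∧
    ContDiffOn ℝ 1 σ U ∧ ContDiffOn ℝ 1 τ V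

/-- The demi-branch `x = λ(y)`, `y ≥ 0`, considered as a subset of the plane. -/
def branchSet (lam : ℝ → ℝ) : Set (ℝ × ℝ) :=
  {p : ℝ × ℝ | 0 ≤ p.2 ∧ p.1 = lam p.2}

/-- The Puiseux support of the branch `y ↦ μ(y^{1/N})`: the set of exponents `k/N` such that
the `k`-th Taylor coefficient of `μ` at `0` is nonzero. -/
def PuiseuxSupport (N : ℕ) (μ : ℝ → ℝ) : Set ℚ :=
  {α | ∃ k : ℕ, iteratedDeriv k μ 0 ≠ 0 ∧ α = (k : ℚ) / (N : ℚ)}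

/-- `α` is a Puiseux characteristic exponent of the branch `y ↦ μ(y^{1/N})`: it lies in the
Puiseux support but not in the additive subgroup of `ℚ` generated by `1` and the smaller
elements of the support. -/
def IsCharExponent (N : ℕ) (μ : ℝ → ℝ) (α : ℚ) : Prop :=
  α ∈ PuiseuxSupport N μ ∧
    α ∉ AddSubgroup.closure (insert (1 : ℚ) {β ∈ PuiseuxSupport N μ | β < α})

open Polynomial in
lemma translation_eq_zero_of_eval_eq {P Q : ℝ[X]} {κ c e : ℝ} (hc : c ≠ 0)
    (h : ∀ v, P.eval v = κ * Q.eval (c * v + e)) (hP : P.natDegree ≠ 0)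
    (hPc : ∀ j, P.coeff j = 0 ∨ P.coeff (j + 1) = 0)
    (hQc : ∀ j, Q.coeff j = 0 ∨ Q.coeff (j + 1) = 0) : e = 0 := by
  have hPQ : P = C κ * (taylor e Q).comp (C c * X) := by
    refine Polynomial.funext fun v => ?_
    simp [h, taylor_eval]
  have hκ : κ ≠ 0 := by
    rintro rfl
    simp [hPQ] at hP
  have hdeg : P.natDegree = Q.natDegree := by
    rw [hPQ, natDegree_C_mul hκ, natDegree_comp, natDegree_C_mul_X _ hc, natDegree_taylor, mul_one]
  obtain ⟨n, hn⟩ : ∃ n, P.natDegree = n + 1 := Nat.exists_eq_succ_of_ne_zero hP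
  have hlast : ∀ R : ℝ[X], R.natDegree = n + 1 → R.coeff (n + 1) ≠ 0 := by
    intro R hR h0
    rw [← hR, coeff_natDegree, leadingCoeff_eq_zero] at h0
    simp [h0] at hR
  have hP1 : P.coeff n = 0 := (hPc n).resolve_right (hlast P hn)
  have hQ0 := hlast Q (hdeg ▸ hn)
  have hQ1 : Q.coeff n = 0 := (hQc n).resolve_right hQ0
  have hH : hasseDeriv n Q = C ((n + 1 : ℕ) * Q.coeff (n + 1)) * X := by
    ext i
    rw [hasseDeriv_coeff, coeff_C_mul, coeff_X]
    rcases i with _ | _ | i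
    · simp [hQ1]
    · simp [add_comm, Nat.choose_succ_self_right]
    · have : Q.coeff (i + 1 + 1 + n) = 0 := by
        apply coeff_eq_zero_of_natDegree_lt
        omega
      simp [this]
  have := hP1
  rw [hPQ, coeff_C_mul, comp_C_mul_X_coeff, taylor_coeff, hH] at this
  have hn1 : ((n : ℝ) + 1) ≠ 0 := by positivity
  simpa [hκ, hc, hQ0, hn1] using this

open Polynomial Asymptotics in
/-- The Taylor polynomial of `f` at the origin, as a bivariate polynomial. -/
lemma exists_bivariate_taylor {f : ℝ × ℝ → ℝ} (hf : AnalyticAt ℝ f 0) {m n : ℕ} (hmn : m < n)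
    (hm : iteratedFDeriv ℝ m f 0 (fun _ => ((1 : ℝ), (0 : ℝ))) ≠ 0) :
    ∃ T : ℝ[X][X], (T.coeff 0).coeff m ≠ 0 ∧
      (fun q : ℝ × ℝ => f q - T.evalEval q.1 q.2) =O[𝓝 0] fun q => ‖q‖ ^ n := by
  classical
  obtain ⟨p, hp⟩ := hf
  have hpm : p m (fun _ => ((1 : ℝ), (0 : ℝ))) ≠ 0 := by
    obtain ⟨r, hr⟩ := hp
    rw [← hr.factorial_smul] at hm
    exact right_ne_zero_of_smul hm
  let e₁ : ℝ × ℝ := (1, 0)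
  let e₂ : ℝ × ℝ := (0, 1)
  let T : ℝ[X][X] := ∑ k ∈ Finset.range n, ∑ s : Finset (Fin k),
    C (C (p k (s.piecewise (fun _ => e₁) (fun _ => e₂)))) * (C X) ^ s.card * X ^ sᶜ.card
  have hT : ∀ x y : ℝ, T.evalEval x y = p.partialSum n (x, y) := by
    intro x y
    simp only [T, FormalMultilinearSeries.partialSum, evalEval_finsetSum]
    refine Finset.sum_congr rfl fun k _ => ?_
    have hxy : (fun _ : Fin k => ((x, y) : ℝ × ℝ)) =
        (fun _ => x • e₁) + (fun _ => y • e₂) := by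
      ext i <;> simp [e₁, e₂]
    have := (p k).toMultilinearMap.map_add_univ (fun _ => x • e₁) (fun _ => y • e₂)
    rw [ContinuousMultilinearMap.coe_coe] at this
    rw [hxy, this]
    refine Finset.sum_congr rfl fun s _ => ?_
    have hs : s.piecewise (fun _ : Fin k => x • e₁) (fun _ => y • e₂) =
        fun i => (if i ∈ s then x else y) • s.piecewise (fun _ => e₁) (fun _ => e₂) i := by
      ext i <;> by_cases hi : i ∈ s <;> simp [hi]
    have h2 := (p k).toMultilinearMap.map_smul_univ (fun i => if i ∈ s then x else y)
      (s.piecewise (fun _ => e₁) (fun _ => e₂))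
    rw [ContinuousMultilinearMap.coe_coe] at h2
    rw [hs, h2, Finset.prod_ite]
    simp [evalEval_mul, evalEval_pow, evalEval_C, Finset.filter_not,
      ← Finset.compl_eq_univ_sdiff]
    ring
  refine ⟨T, ?_, ?_⟩
  · have : T.coeff 0 = ∑ k ∈ Finset.range n, monomial k (p k (fun _ => e₁)) := by
      refine Polynomial.funext fun x => ?_
      have h1 : (T.coeff 0).eval x = T.evalEval x 0 := by
        rw [coeff_zero_eq_eval_zero, evalEval, C_0]
      rw [h1, hT, eval_finsetSum]
      refine Finset.sum_congr rfl fun k _ => ?_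
      have hx : (fun _ : Fin k => ((x, 0) : ℝ × ℝ)) = fun i => x • e₁ := by
        ext i <;> simp [e₁]
      rw [hx]
      have h2 := (p k).toMultilinearMap.map_smul_univ (fun i => x) (fun _ => e₁)
      rw [ContinuousMultilinearMap.coe_coe] at h2
      rw [h2]
      simp [mul_comm]
    rw [this, finsetSum_coeff, Finset.sum_eq_single m]
    · simpa using hpm
    · intro k _ hk
      simp [coeff_monomial, hk]
    · simp [hmn]
  · have := hp.isBigO_sub_partialSum_pow n
    simpa only [zero_add, hT] using this

open Polynomial in
/-- Substituting `x + L(t)` for `x` and `t ^ M` for `y` in a bivariate polynomial. -/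
lemma exists_bivariate_subst (T : ℝ[X][X]) {L : ℝ[X]} {M : ℕ} (hM : M ≠ 0)
    (hL0 : L.coeff 0 = 0) (Γ : AddSubgroup ℤ) (hL : ∀ i, L.coeff i ≠ 0 → (i : ℤ) ∈ Γ)
    (hMΓ : (M : ℤ) ∈ Γ) :
    ∃ S : ℝ[X][X], S.coeff 0 = T.coeff 0 ∧ (∀ i, S.coeff i ≠ 0 → (i : ℤ) ∈ Γ) ∧
      ∀ s t, S.evalEval s t = T.evalEval (s + L.eval t) (t ^ M) := by
  let A : Subring ℝ[X][X] :=
    { carrier := {S | ∀ i, S.coeff i ≠ 0 → (i : ℤ) ∈ Γ}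
      mul_mem' := by
        intro a b ha hb i hi
        rw [coeff_mul] at hi
        obtain ⟨⟨j, k⟩, hjk, h⟩ := Finset.exists_ne_zero_of_sum_ne_zero hi
        rw [Finset.HasAntidiagonal.mem_antidiagonal] at hjk
        rw [← hjk]
        push_cast
        exact Γ.add_mem (ha _ (left_ne_zero_of_mul h)) (hb _ (right_ne_zero_of_mul h))
      one_mem' := by
        intro i hi
        rw [coeff_one] at hi
        simp_all
      add_mem' := by
        intro a b ha hb i hi
        rw [coeff_add] at hi
        by_cases h : a.coeff i = 0
        · exact hb i (by simpa [h] using hi)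
        · exact ha i h
      zero_mem' := by simp
      neg_mem' := by
        intro a ha i hi
        exact ha i (by simpa using hi) }
  have hCA : ∀ a : ℝ[X], C a ∈ A := by
    intro a i hi
    rw [coeff_C] at hi
    simp_all
  let L' : ℝ[X][X] := L.map C
  have hL' : L' ∈ A := by
    intro i hi
    refine hL i fun h => hi ?_
    simp [L', h]
  have hXM : (X : ℝ[X][X]) ^ M ∈ A := by
    intro i hi
    rw [coeff_X_pow] at hi
    simp_all
  let φ : ℝ[X] →+* ℝ[X][X] := eval₂RingHom ((C : ℝ[X] →+* ℝ[X][X]).comp C) (C X + L')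
  let S : ℝ[X][X] := eval₂ φ (X ^ M) T
  have hφ : ∀ a, φ a ∈ A := by
    intro a
    change eval₂ _ _ a ∈ A
    rw [eval₂_eq_sum_range]
    exact A.sum_mem fun i _ => A.mul_mem (hCA _) (A.pow_mem (A.add_mem (hCA _) hL') _)
  have hS : S ∈ A := by
    change eval₂ _ _ T ∈ A
    rw [eval₂_eq_sum_range]
    exact A.sum_mem fun i _ => A.mul_mem (hφ _) (A.pow_mem hXM _)
  have hev : ∀ s t, S.evalEval s t = T.evalEval (s + L.eval t) (t ^ M) := by
    intro s t
    have h1 : (evalEvalRingHom s t).comp φ = evalRingHom (s + L.eval t) := by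
      ext
      · simp [φ]
      · simp [φ, L']
    change evalEvalRingHom s t (eval₂ φ (X ^ M) T) = _
    rw [hom_eval₂, h1, ← eval₂_evalRingHom]
    simp
  refine ⟨S, Polynomial.funext fun s => ?_, hS, hev⟩
  have h1 : ∀ R : ℝ[X][X], (R.coeff 0).eval s = R.evalEval s 0 := by
    intro R
    rw [coeff_zero_eq_eval_zero, evalEval, C_0]
  rw [h1, h1, hev, ← coeff_zero_eq_eval_zero, hL0, zero_pow hM, add_zero]

open Polynomial Asymptotics in
/-- The initial form of `f` along the arc `x = L(t) + w t ^ p`, `y = t ^ M`. -/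
lemma exists_initial_form {f : ℝ × ℝ → ℝ} (hf : AnalyticAt ℝ f 0) {m : ℕ}
    (hm : iteratedFDeriv ℝ m f 0 (fun _ => ((1 : ℝ), (0 : ℝ))) ≠ 0)
    {L : ℝ[X]} {M p : ℕ} (hM : M ≠ 0) (hp : p ≠ 0)
    (hL0 : L.coeff 0 = 0) (Γ : AddSubgroup ℤ) (hL : ∀ i, L.coeff i ≠ 0 → (i : ℤ) ∈ Γ)
    (hMΓ : (M : ℤ) ∈ Γ) (hpΓ : (p : ℤ) ∉ Γ) :
    ∃ (β : ℕ) (P : ℝ[X]), P ≠ 0 ∧ (∀ j, P.coeff j = 0 ∨ P.coeff (j + 1) = 0) ∧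
      ∀ w₀ : ℝ, Tendsto (fun q : ℝ × ℝ => f (L.eval q.1 + q.2 * q.1 ^ p, q.1 ^ M) / q.1 ^ β)
        (𝓝[>] 0 ×ˢ 𝓝 w₀) (𝓝 (P.eval w₀)) := by
  classical
  obtain ⟨T, hTm, hTO⟩ := exists_bivariate_taylor hf (n := p * m + m + 1) (by omega) hm
  obtain ⟨S, hS0, hSΓ, hST⟩ := exists_bivariate_subst T hM hL0 Γ hL hMΓ
  have hex : ∃ b, ∃ i j, i + p * j = b ∧ (S.coeff i).coeff j ≠ 0 :=
    ⟨_, 0, m, rfl, by rwa [hS0]⟩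
  obtain ⟨β, ⟨i₀, j₀, hij₀, hc₀⟩, hmin⟩ : ∃ β, (∃ i j, i + p * j = β ∧ (S.coeff i).coeff j ≠ 0) ∧
      ∀ i j, (S.coeff i).coeff j ≠ 0 → β ≤ i + p * j :=
    ⟨Nat.find hex, Nat.find_spec hex, fun i j h => Nat.find_min' hex ⟨i, j, rfl, h⟩⟩
  have hβ : β ≤ p * m := by simpa using hmin 0 m (by rwa [hS0])
  let A := S.natDegree + 1
  let B := (Finset.range A).sup (fun i => (S.coeff i).natDegree) + 1
  have hA : ∀ i j, (S.coeff i).coeff j ≠ 0 → i ∈ Finset.range A := by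
    intro i j h
    by_contra hi
    simp only [A, Finset.mem_range, not_lt] at hi
    exact h (by rw [coeff_eq_zero_of_natDegree_lt (p := S) hi, coeff_zero])
  have hB : ∀ i ∈ Finset.range A, (S.coeff i).natDegree < B := fun i hi =>
    Nat.lt_succ_of_le (Finset.le_sup (f := fun i => (S.coeff i).natDegree) hi)
  have hev : ∀ s t, S.evalEval s t =
      ∑ i ∈ Finset.range A, ∑ j ∈ Finset.range B, (S.coeff i).coeff j * s ^ j * t ^ i := by
    intro s t
    rw [evalEval, eval_eq_sum_range (p := S), eval_finsetSum]
    refine Finset.sum_congr rfl fun i hi => ?_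
    rw [eval_mul, eval_eq_sum_range' (hB i hi), Finset.sum_mul]
    simp
  let P : ℝ[X] := ∑ i ∈ Finset.range A, ∑ j ∈ Finset.range B,
    if i + p * j = β then monomial j ((S.coeff i).coeff j) else 0
  have hPco : ∀ k, P.coeff k = ∑ i ∈ Finset.range A, ∑ j ∈ Finset.range B,
      if i + p * j = β ∧ j = k then (S.coeff i).coeff j else 0 := by
    intro k
    simp only [P, finsetSum_coeff]
    refine Finset.sum_congr rfl fun i _ => Finset.sum_congr rfl fun j _ => ?_
    by_cases h : i + p * j = β <;> simp [h, coeff_monomial]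
  have hPne : ∀ k, P.coeff k ≠ 0 → (β : ℤ) - p * k ∈ Γ := by
    intro k hk
    rw [hPco] at hk
    obtain ⟨i, _, hi⟩ := Finset.exists_ne_zero_of_sum_ne_zero hk
    obtain ⟨j, _, hj⟩ := Finset.exists_ne_zero_of_sum_ne_zero hi
    obtain ⟨⟨h1, rfl⟩, h2⟩ := ite_ne_right_iff.mp hj
    have : ((β : ℕ) : ℤ) - p * j = i := by
      rw [← h1]
      push_cast
      ring
    rw [this]
    exact hSΓ i fun h => h2 (by rw [h, coeff_zero])
  refine ⟨β, P, ?_, ?_, ?_⟩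
  · intro hP
    have : P.coeff j₀ = (S.coeff i₀).coeff j₀ := by
      have hi₀ := hA _ _ hc₀
      have hj₀ : j₀ ∈ Finset.range B := by
        rw [Finset.mem_range]
        exact lt_of_le_of_lt (le_natDegree_of_ne_zero hc₀) (hB _ hi₀)
      rw [hPco, Finset.sum_eq_single_of_mem i₀ hi₀, Finset.sum_eq_single_of_mem j₀ hj₀]
      · simp [hij₀]
      · intro j _ hj
        simp [hj]
      · intro i _ hi
        refine Finset.sum_eq_zero fun j _ => if_neg ?_
        rintro ⟨h, rfl⟩
        omega
    exact hc₀ (by rw [← this, hP, coeff_zero])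
  · intro j
    by_contra! h
    apply hpΓ
    have := Γ.sub_mem (hPne _ h.1) (hPne _ h.2)
    convert this using 1
    push_cast
    ring
  · intro w₀
    have ht : Tendsto (fun q : ℝ × ℝ => q.1) (𝓝[>] 0 ×ˢ 𝓝 w₀) (𝓝[>] 0) := tendsto_fst
    have ht0 : Tendsto (fun q : ℝ × ℝ => q.1) (𝓝[>] 0 ×ˢ 𝓝 w₀) (𝓝 0) :=
      ht.mono_right nhdsWithin_le_nhds
    have hw : Tendsto (fun q : ℝ × ℝ => q.2) (𝓝[>] 0 ×ˢ 𝓝 w₀) (𝓝 w₀) := tendsto_snd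
    have hpos : ∀ᶠ q : ℝ × ℝ in 𝓝[>] 0 ×ˢ 𝓝 w₀, 0 < q.1 :=
      ht.eventually self_mem_nhdsWithin
    obtain ⟨L₁, rfl⟩ := X_dvd_iff.mpr hL0
    let γ : ℝ × ℝ → ℝ × ℝ := fun q =>
      ((X * L₁).eval q.1 + q.2 * q.1 ^ p, q.1 ^ M)
    have hγO : γ =O[𝓝[>] 0 ×ˢ 𝓝 w₀] fun q => q.1 := by
      have h1 : Tendsto (fun q : ℝ × ℝ => L₁.eval q.1 + q.2 * q.1 ^ (p - 1))
          (𝓝[>] 0 ×ˢ 𝓝 w₀) (𝓝 (L₁.eval 0 + w₀ * 0 ^ (p - 1))) :=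
        ((L₁.continuous.tendsto 0).comp ht0).add (hw.mul (ht0.pow _))
      have h2 : Tendsto (fun q : ℝ × ℝ => q.1 ^ (M - 1))
          (𝓝[>] 0 ×ˢ 𝓝 w₀) (𝓝 (0 ^ (M - 1))) := ht0.pow _
      refine IsBigO.prod_left ?_ ?_
      · have := (isBigO_refl (fun q : ℝ × ℝ => q.1) (𝓝[>] 0 ×ˢ 𝓝 w₀)).mul (h1.isBigO_one ℝ)
        refine (this.congr_left fun q => ?_).congr_right fun q => mul_one _
        obtain ⟨k, rfl⟩ := Nat.exists_eq_succ_of_ne_zero hp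
        simp [pow_succ]
        ring
      · have := (isBigO_refl (fun q : ℝ × ℝ => q.1) (𝓝[>] 0 ×ˢ 𝓝 w₀)).mul (h2.isBigO_one ℝ)
        refine (this.congr_left fun q => ?_).congr_right fun q => mul_one _
        obtain ⟨k, rfl⟩ := Nat.exists_eq_succ_of_ne_zero hM
        simp [pow_succ]
        ring
    have hγ0 : Tendsto γ (𝓝[>] 0 ×ˢ 𝓝 w₀) (𝓝 0) := hγO.trans_tendsto ht0
    have herr : Tendsto (fun q : ℝ × ℝ => (f (γ q) - T.evalEval (γ q).1 (γ q).2) / q.1 ^ β)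
        (𝓝[>] 0 ×ˢ 𝓝 w₀) (𝓝 0) := by
      refine IsLittleO.tendsto_div_nhds_zero ?_
      refine ((hTO.comp_tendsto hγ0).trans (hγO.norm_left.pow _)).trans_isLittleO ?_
      exact (isLittleO_pow_pow (by omega : β < p * m + m + 1)).comp_tendsto ht0
    have hmain : Tendsto (fun q : ℝ × ℝ => S.evalEval (q.2 * q.1 ^ p) q.1 / q.1 ^ β)
        (𝓝[>] 0 ×ˢ 𝓝 w₀) (𝓝 (P.eval w₀)) := by
      have hPe : P.eval w₀ = ∑ i ∈ Finset.range A, ∑ j ∈ Finset.range B,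
          if i + p * j = β then (S.coeff i).coeff j * w₀ ^ j else 0 := by
        simp only [P, eval_finsetSum]
        refine Finset.sum_congr rfl fun i _ => Finset.sum_congr rfl fun j _ => ?_
        by_cases h : i + p * j = β <;> simp [h]
      simp only [hev, Finset.sum_div, hPe]
      refine tendsto_finsetSum _ fun i _ => tendsto_finsetSum _ fun j _ => ?_
      by_cases hc : (S.coeff i).coeff j = 0
      · simp [hc]
      obtain ⟨d, hd⟩ := Nat.exists_eq_add_of_le (hmin i j hc)
      have hlim : Tendsto (fun q : ℝ × ℝ => (S.coeff i).coeff j * q.2 ^ j * q.1 ^ d)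
          (𝓝[>] 0 ×ˢ 𝓝 w₀) (𝓝 ((S.coeff i).coeff j * w₀ ^ j * 0 ^ d)) :=
        ((hw.pow j).const_mul _).mul (ht0.pow d)
      have hval : (if i + p * j = β then (S.coeff i).coeff j * w₀ ^ j else 0) =
          (S.coeff i).coeff j * w₀ ^ j * 0 ^ d := by
        rcases Nat.eq_zero_or_pos d with rfl | hd'
        · simp [hd]
        · rw [if_neg (by omega), zero_pow (by omega), mul_zero]
      rw [hval]
      refine hlim.congr' ?_
      filter_upwards [hpos] with q hq
      rw [eq_div_iff (by positivity), mul_assoc _ (q.1 ^ d), ← pow_add, add_comm d, ← hd,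
        mul_pow, ← pow_mul, pow_add]
      ring
    have := herr.add hmain
    rw [zero_add] at this
    refine this.congr fun q => ?_
    rw [← add_div, hST]
    simp only [γ, add_comm, add_sub_cancel]

open Polynomial in
/-- Truncation of `t ↦ μ (t ^ q)` below order `p`, together with its coefficient at order `p`. -/
lemma exists_puiseux_truncation {μ : ℝ → ℝ} (hμ : AnalyticAt ℝ μ 0) (hμ0 : μ 0 = 0) {q : ℕ}
    (hq : q ≠ 0) (p : ℕ) :
    ∃ (L : ℝ[X]) (a : ℝ), L.coeff 0 = 0 ∧
      (∀ i, L.coeff i ≠ 0 → ∃ k, i = q * k ∧ i < p ∧ iteratedDeriv k μ 0 ≠ 0) ∧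
      (∀ k, q * k = p → a = iteratedDeriv k μ 0 / k.factorial) ∧ (¬ q ∣ p → a = 0) ∧
      Tendsto (fun t : ℝ => (μ (t ^ q) - L.eval t) / t ^ p) (𝓝[>] 0) (𝓝 a) := by
  obtain ⟨F, hF, hμF⟩ := hμ.exists_eventuallyEq_sum_add_pow_mul (p + 1)
  let d : ℕ → ℝ := fun k => iteratedDeriv k μ 0
  let L : ℝ[X] := ∑ k ∈ Finset.range (p + 1),
    if q * k < p then monomial (q * k) (d k / k.factorial) else 0
  let a : ℝ := ∑ k ∈ Finset.range (p + 1), if q * k = p then d k / k.factorial else 0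
  have hL : ∀ i, L.coeff i ≠ 0 → ∃ k, i = q * k ∧ i < p ∧ d k ≠ 0 := by
    intro i hi
    simp only [L, finsetSum_coeff] at hi
    obtain ⟨k, -, hk⟩ := Finset.exists_ne_zero_of_sum_ne_zero hi
    split_ifs at hk with h
    · rw [coeff_monomial] at hk
      split_ifs at hk with h'
      · exact ⟨k, h'.symm, h' ▸ h, fun h0 => hk (by simp [h0])⟩
      · exact absurd rfl hk
    · simp at hk
  have ht : Tendsto (fun t : ℝ => t) (𝓝[>] 0) (𝓝 0) := tendsto_id'.mpr nhdsWithin_le_nhds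
  have htq : Tendsto (fun t : ℝ => t ^ q) (𝓝[>] 0) (𝓝 0) := by
    simpa [hq] using ht.pow q
  refine ⟨L, a, ?_, hL, ?_, ?_, ?_⟩
  · by_contra h
    obtain ⟨k, h1, -, h2⟩ := hL 0 h
    obtain rfl : k = 0 := by simpa [hq] using h1.symm
    exact h2 (by simpa [d] using hμ0)
  · intro k hk
    have hkp : k ∈ Finset.range (p + 1) := by
      rw [Finset.mem_range]
      have := Nat.le_mul_of_pos_left k (Nat.pos_of_ne_zero hq)
      omega
    simp only [a]
    rw [Finset.sum_eq_single_of_mem k hkp]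
    · simp [hk, d]
    · intro j _ hj
      refine if_neg fun h => hj ?_
      exact Nat.eq_of_mul_eq_mul_left (Nat.pos_of_ne_zero hq) (h.trans hk.symm)
  · intro hqp
    refine Finset.sum_eq_zero fun k _ => if_neg fun h => hqp ⟨k, h.symm⟩
  · have hlim : Tendsto (fun t : ℝ => (∑ k ∈ Finset.range (p + 1),
        if q * k < p then 0 else d k / k.factorial * t ^ (q * k - p)) +
          t ^ (q * (p + 1) - p) * F (t ^ q)) (𝓝[>] 0) (𝓝 a) := by
      have hlt : 0 < q * (p + 1) - p := by
        have := Nat.le_mul_of_pos_left (p + 1) (Nat.pos_of_ne_zero hq)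
        omega
      have h2 : Tendsto (fun t : ℝ => t ^ (q * (p + 1) - p) * F (t ^ q)) (𝓝[>] 0) (𝓝 0) := by
        have := (ht.pow (q * (p + 1) - p)).mul (hF.continuousAt.tendsto.comp htq)
        rwa [zero_pow hlt.ne', zero_mul] at this
      rw [← add_zero a]
      refine Tendsto.add (tendsto_finsetSum _ fun k _ => ?_) h2
      rcases lt_trichotomy (q * k) p with h | h | h
      · simp [h, h.ne]
      · simp [h]
      · have h3 : Tendsto (fun t : ℝ => d k / k.factorial * t ^ (q * k - p)) (𝓝[>] 0) (𝓝 0) := by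
          have := (ht.pow (q * k - p)).const_mul (d k / k.factorial)
          rwa [zero_pow (by omega), mul_zero] at this
        simpa [h.not_gt, h.ne'] using h3
    refine hlim.congr' ?_
    filter_upwards [htq.eventually hμF, self_mem_nhdsWithin] with t ht1 ht2
    have ht2 : 0 < t := ht2
    rw [ht1, eq_div_iff (by positivity), add_mul, Finset.sum_mul]
    have h1 : L.eval t = ∑ k ∈ Finset.range (p + 1),
        if q * k < p then d k / k.factorial * t ^ (q * k) else 0 := by
      simp only [L, eval_finsetSum]
      refine Finset.sum_congr rfl fun k _ => ?_
      split_ifs <;> simp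
    have hle : p ≤ q * (p + 1) := by
      have := Nat.le_mul_of_pos_left (p + 1) (Nat.pos_of_ne_zero hq)
      omega
    rw [h1, add_sub_right_comm, ← Finset.sum_sub_distrib]
    congr 1
    · refine Finset.sum_congr rfl fun k _ => ?_
      split_ifs with h
      · simp [d, pow_mul]
        ring
      · rw [mul_assoc, ← pow_add, Nat.sub_add_cancel (not_lt.mp h), pow_mul]
        simp only [d, smul_eq_mul, sub_zero]
        ring
    · rw [mul_right_comm, ← pow_add, Nat.sub_add_cancel hle, pow_mul, smul_eq_mul]

/-- An allowable branch has Puiseux exponents at least one. -/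
lemma exists_eq_pow_mul_of_allowable {μ lam : ℝ → ℝ} (hμ : AnalyticAt ℝ μ 0) {N : ℕ} (hN : 0 < N)
    (hlam : ∀ᶠ y in 𝓝[≥] (0 : ℝ), lam y = μ (y ^ ((N : ℝ)⁻¹)))
    (hallow : ∃ C > (0 : ℝ), ∀ᶠ y in 𝓝[≥] (0 : ℝ), |lam y| ≤ C * y) :
    (∀ k < N, iteratedDeriv k μ 0 = 0) ∧
      ∃ h : ℝ → ℝ, AnalyticAt ℝ h 0 ∧
        ∀ᶠ y in 𝓝[≥] (0 : ℝ), lam y = y * h (y ^ ((N : ℝ)⁻¹)) := by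
  have hroot : Tendsto (fun y : ℝ => y ^ ((N : ℝ)⁻¹)) (𝓝[≥] 0) (𝓝 0) := by
    have := (Real.continuousAt_rpow_const (0 : ℝ) ((N : ℝ)⁻¹) (Or.inr (by positivity))).tendsto
    rw [Real.zero_rpow (by positivity)] at this
    exact this.mono_left nhdsWithin_le_nhds
  have hpow : Tendsto (fun s : ℝ => s ^ N) (𝓝[>] 0) (𝓝[≥] 0) := by
    refine tendsto_nhdsWithin_iff.mpr ⟨?_, ?_⟩
    · have := ((continuous_pow N).tendsto (0 : ℝ)).mono_left (nhdsWithin_le_nhds (s := Set.Ioi 0))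
      simpa [hN.ne'] using this
    · filter_upwards [self_mem_nhdsWithin] with s hs
      exact pow_nonneg (Set.mem_Ioi.mp hs).le N
  obtain ⟨C, hC, hCl⟩ := hallow
  have hbound : ∀ᶠ s in 𝓝[>] (0 : ℝ), |μ s| ≤ C * s ^ N := by
    filter_upwards [hpow.eventually hlam, hpow.eventually hCl, self_mem_nhdsWithin] with s h1 h2 h3
    rw [Real.pow_rpow_inv_natCast (le_of_lt h3) hN.ne'] at h1
    rwa [← h1]
  have hord : (N : ℕ∞) ≤ analyticOrderAt μ 0 := by
    by_contra! hlt
    obtain ⟨k, hk⟩ := ENat.ne_top_iff_exists.mp hlt.ne_top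
    rw [← hk, Nat.cast_lt] at hlt
    obtain ⟨g, hg, hg0, hμg⟩ := hμ.analyticOrderAt_eq_natCast.mp hk.symm
    have hid : Tendsto (fun s : ℝ => s) (𝓝[>] 0) (𝓝 0) := tendsto_id'.mpr nhdsWithin_le_nhds
    have h1 : Tendsto (fun s : ℝ => C * s ^ (N - k)) (𝓝[>] 0) (𝓝 0) := by
      have := (hid.pow (N - k)).const_mul C
      rwa [zero_pow (by omega), mul_zero] at this
    have h2 : Tendsto g (𝓝[>] 0) (𝓝 0) := by
      refine squeeze_zero_norm' ?_ h1
      filter_upwards [hbound, hid.eventually hμg, self_mem_nhdsWithin] with s hs1 hs2 hs3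
      have hs3 : 0 < s := hs3
      rw [hs2, sub_zero, smul_eq_mul, abs_mul, abs_of_pos (pow_pos hs3 k)] at hs1
      have : s ^ N = s ^ k * s ^ (N - k) := by rw [← pow_add, Nat.add_sub_cancel' hlt.le]
      rw [this] at hs1
      rw [Real.norm_eq_abs]
      refine le_of_mul_le_mul_left ?_ (pow_pos hs3 k)
      linarith
    exact hg0 (tendsto_nhds_unique (hg.continuousAt.tendsto.comp hid) h2)
  refine ⟨fun k hk => (natCast_le_analyticOrderAt_iff_iteratedDeriv_eq_zero hμ).mp hord k hk, ?_⟩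
  obtain ⟨h, hh, hμh⟩ := (natCast_le_analyticOrderAt hμ).mp hord
  refine ⟨h, hh, ?_⟩
  filter_upwards [hlam, hroot.eventually hμh, self_mem_nhdsWithin] with y h1 h2 h3
  rw [h1, h2, sub_zero, Real.rpow_inv_natCast_pow h3 hN.ne', smul_eq_mul]

open Asymptotics in
/-- One-sided strict differentiability at the origin of `y ↦ y * h (y ^ (1 / N))`. -/
lemma isLittleO_branch_sub {h : ℝ → ℝ} (hh : AnalyticAt ℝ h 0) {N : ℕ} (hN : 0 < N) :
    (fun q : ℝ × ℝ => q.1 * h (q.1 ^ ((N : ℝ)⁻¹)) - q.2 * h (q.2 ^ ((N : ℝ)⁻¹))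
      - h 0 * (q.1 - q.2)) =o[𝓝[>] 0 ×ˢ 𝓝[>] 0] fun q => q.1 - q.2 := by
  have hroot : Tendsto (fun y : ℝ => y ^ ((N : ℝ)⁻¹)) (𝓝[>] 0) (𝓝 0) := by
    have := (Real.continuousAt_rpow_const (0 : ℝ) ((N : ℝ)⁻¹) (Or.inr (by positivity))).tendsto
    rw [Real.zero_rpow (by positivity)] at this
    exact this.mono_left nhdsWithin_le_nhds
  have h1 : Tendsto (fun q : ℝ × ℝ => q.1 ^ ((N : ℝ)⁻¹)) (𝓝[>] 0 ×ˢ 𝓝[>] 0) (𝓝 0) :=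
    hroot.comp tendsto_fst
  have h2 : Tendsto (fun q : ℝ × ℝ => q.2 ^ ((N : ℝ)⁻¹)) (𝓝[>] 0 ×ˢ 𝓝[>] 0) (𝓝 0) :=
    hroot.comp tendsto_snd
  have hp1 : ∀ᶠ q : ℝ × ℝ in 𝓝[>] 0 ×ˢ 𝓝[>] 0, 0 < q.1 :=
    tendsto_fst.eventually self_mem_nhdsWithin
  have hp2 : ∀ᶠ q : ℝ × ℝ in 𝓝[>] 0 ×ˢ 𝓝[>] 0, 0 < q.2 :=
    tendsto_snd.eventually self_mem_nhdsWithin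
  obtain ⟨K, U, hU, hK⟩ := (hh.contDiffAt (n := 1)).exists_lipschitzOnWith
  let w : ℝ × ℝ → ℝ := fun q =>
    |h (q.1 ^ ((N : ℝ)⁻¹)) - h 0| + K * q.2 ^ ((N : ℝ)⁻¹)
  have hw : Tendsto w (𝓝[>] 0 ×ˢ 𝓝[>] 0) (𝓝 0) := by
    have := (((hh.continuousAt.tendsto.comp h1).sub_const (h 0)).abs).add (h2.const_mul (K : ℝ))
    simpa using this
  have hbound : (fun q : ℝ × ℝ => q.1 * h (q.1 ^ ((N : ℝ)⁻¹)) - q.2 * h (q.2 ^ ((N : ℝ)⁻¹))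
      - h 0 * (q.1 - q.2)) =O[𝓝[>] 0 ×ˢ 𝓝[>] 0] fun q => w q * (q.1 - q.2) := by
    refine IsBigO.of_bound 1 ?_
    filter_upwards [hp1, hp2, h1.eventually hU, h2.eventually hU] with q hq1 hq2 hu1 hu2
    obtain ⟨y₁, y₂⟩ := q
    simp only at hq1 hq2 hu1 hu2
    have hs1 : (y₁ ^ ((N : ℝ)⁻¹)) ^ N = y₁ := Real.rpow_inv_natCast_pow hq1.le hN.ne'
    have hs2 : (y₂ ^ ((N : ℝ)⁻¹)) ^ N = y₂ := Real.rpow_inv_natCast_pow hq2.le hN.ne'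
    have hs1p := Real.rpow_pos_of_pos hq1 ((N : ℝ)⁻¹)
    have hs2p := Real.rpow_pos_of_pos hq2 ((N : ℝ)⁻¹)
    have hlip := hK.dist_le_mul _ hu1 _ hu2
    simp only [w, one_mul, Real.norm_eq_abs]
    generalize y₁ ^ ((N : ℝ)⁻¹) = s₁ at *
    generalize y₂ ^ ((N : ℝ)⁻¹) = s₂ at *
    rw [Real.dist_eq, Real.dist_eq] at hlip
    have hkey : y₂ * |s₁ - s₂| ≤ s₂ * |y₁ - y₂| := by
      obtain ⟨n, rfl⟩ := Nat.exists_eq_succ_of_ne_zero hN.ne'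
      have hgeom : y₁ - y₂ =
          (∑ i ∈ Finset.range (n + 1), s₁ ^ i * s₂ ^ (n + 1 - 1 - i)) * (s₁ - s₂) := by
        rw [← hs1, ← hs2]
        exact (Commute.geom_sum₂_mul (Commute.all s₁ s₂) (n + 1)).symm
      have hge : s₂ ^ n ≤ ∑ i ∈ Finset.range (n + 1), s₁ ^ i * s₂ ^ (n + 1 - 1 - i) := by
        have := Finset.single_le_sum (f := fun i => s₁ ^ i * s₂ ^ (n + 1 - 1 - i))
          (fun i _ => by positivity) (Finset.mem_range.mpr (Nat.succ_pos n))
        simpa using this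
      rw [hgeom, abs_mul, abs_of_nonneg ((pow_pos hs2p n).le.trans hge), ← hs2,
        Nat.succ_eq_add_one, pow_succ', mul_assoc]
      gcongr
    have hdec : y₁ * h s₁ - y₂ * h s₂ - h 0 * (y₁ - y₂) =
        (h s₁ - h 0) * (y₁ - y₂) + y₂ * (h s₁ - h s₂) := by ring
    rw [hdec, abs_mul, abs_of_nonneg (by positivity : 0 ≤ |h s₁ - h 0| + K * s₂)]
    refine (abs_add_le _ _).trans ?_
    rw [abs_mul, abs_mul, abs_of_pos hq2, add_mul]
    refine add_le_add le_rfl ?_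
    calc y₂ * |h s₁ - h s₂| ≤ y₂ * (K * |s₁ - s₂|) := by gcongr
      _ = K * (y₂ * |s₁ - s₂|) := by ring
      _ ≤ K * (s₂ * |y₁ - y₂|) := by gcongr
      _ = K * s₂ * |y₁ - y₂| := by ring
  refine hbound.trans_isLittleO ?_
  simpa using ((isLittleO_one_iff ℝ).mpr hw).mul_isBigO
    (isBigO_refl (fun q : ℝ × ℝ => q.1 - q.2) (𝓝[>] 0 ×ˢ 𝓝[>] 0))

lemma det_prod_eq (D : ℝ × ℝ →L[ℝ] ℝ × ℝ) :
    LinearMap.det (D : (ℝ × ℝ) →ₗ[ℝ] (ℝ × ℝ)) =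
      (D (1, 0)).1 * (D (0, 1)).2 - (D (0, 1)).1 * (D (1, 0)).2 := by
  rw [← LinearMap.det_toMatrix (Module.Basis.finTwoProd ℝ), Matrix.det_fin_two]
  simp [LinearMap.toMatrix_apply]

open Asymptotics in
/-- Effect of a strictly differentiable map, sending one branch into another, on horizontal
displacements from the branch. -/
lemma exists_horizontal_displacement {σ : ℝ × ℝ → ℝ × ℝ} {D : ℝ × ℝ →L[ℝ] ℝ × ℝ}
    (hσ : HasStrictFDerivAt σ D 0) (hσ0 : σ 0 = 0) (hD : Function.Injective D)
    {lam lam' : ℝ → ℝ} {a₁ a₁' C : ℝ}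
    (hl : Tendsto (fun y => lam y / y) (𝓝[>] 0) (𝓝 a₁))
    (hbound : ∀ᶠ y in 𝓝[≥] (0 : ℝ), |lam' y| ≤ C * y)
    (hl' : Tendsto (fun y => lam' y / y) (𝓝[>] 0) (𝓝 a₁'))
    (hstrict : (fun q : ℝ × ℝ => lam' q.1 - lam' q.2 - a₁' * (q.1 - q.2))
      =o[𝓝[>] 0 ×ˢ 𝓝[>] 0] fun q => q.1 - q.2)
    (himage : ∀ᶠ y in 𝓝[>] (0 : ℝ),
      0 ≤ (σ (lam y, y)).2 ∧ (σ (lam y, y)).1 = lam' (σ (lam y, y)).2) :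
    ∃ b c : ℝ, 0 < b ∧ c ≠ 0 ∧ LinearMap.det (D : (ℝ × ℝ) →ₗ[ℝ] (ℝ × ℝ)) = b * c ∧
      ∀ (l : Filter ℝ) (y e : ℝ → ℝ), Tendsto y l (𝓝[>] 0) → e =o[l] y →
        Tendsto (fun i => (lam (y i) + e i, y i)) l (𝓝 (0 : ℝ × ℝ)) ∧
        Tendsto (fun i => (σ (lam (y i) + e i, y i)).2 / y i) l (𝓝 b) ∧
        (fun i => (σ (lam (y i) + e i, y i)).1 - lam' (σ (lam (y i) + e i, y i)).2 - c * e i)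
          =o[l] e := by
  have hpos : ∀ {l : Filter ℝ} {y : ℝ → ℝ}, Tendsto y l (𝓝[>] 0) → ∀ᶠ i in l, 0 < y i :=
    fun h => h.eventually self_mem_nhdsWithin
  have hzero : ∀ {l : Filter ℝ} {y : ℝ → ℝ}, Tendsto y l (𝓝[>] 0) → Tendsto y l (𝓝 0) :=
    fun h => h.mono_right nhdsWithin_le_nhds
  have hlim : ∀ (l : Filter ℝ) (y e : ℝ → ℝ), Tendsto y l (𝓝[>] 0) → e =o[l] y →
      Tendsto (fun i => (lam (y i) + e i, y i)) l (𝓝 (0 : ℝ × ℝ)) ∧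
      Tendsto (fun i => (y i)⁻¹ • σ (lam (y i) + e i, y i)) l (𝓝 (D (a₁, 1))) := by
    intro l y e hy he
    have h1 : Tendsto (fun i => (y i)⁻¹ • ((lam (y i) + e i, y i) : ℝ × ℝ)) l
        (𝓝 (a₁, 1)) := by
      have h2 := ((hl.comp hy).add he.tendsto_div_nhds_zero).prodMk_nhds
        (tendsto_const_nhds (x := (1 : ℝ)))
      rw [add_zero] at h2
      refine h2.congr' ?_
      filter_upwards [hpos hy] with i hi
      ext
      · simp
        ring
      · simp [hi.ne']
    have hO : (fun i => ((lam (y i) + e i, y i) : ℝ × ℝ)) =O[l] y := by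
      have := (isBigO_refl y l).smul (h1.isBigO_one ℝ)
      refine (this.congr' ?_ (Eventually.of_forall fun i => by simp))
      filter_upwards [hpos hy] with i hi
      rw [smul_inv_smul₀ hi.ne']
    have h0 := hO.trans_tendsto (hzero hy)
    refine ⟨h0, ?_⟩
    have hd := ((hasFDerivAt_iff_isLittleO_nhds_zero.mp hσ.hasFDerivAt).comp_tendsto h0).trans_isBigO
      hO
    have hd' := (isLittleO_one_iff ℝ).mp (((isBigO_refl (fun i => (y i)⁻¹) l).smul_isLittleO hd).congr'
      EventuallyEq.rfl (show (fun i => (y i)⁻¹ • y i) =ᶠ[l] fun _ => (1 : ℝ) by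
        filter_upwards [hpos hy] with i hi
        simp [hi.ne']))
    have := hd'.add ((D.continuous.tendsto _).comp h1)
    rw [zero_add] at this
    refine this.congr fun i => ?_
    simp only [Function.comp_apply, zero_add, hσ0, sub_zero, smul_sub, map_smul, sub_add_cancel]
  have hid : Tendsto (fun y : ℝ => y) (𝓝[>] 0) (𝓝[>] 0) := tendsto_id
  set b := (D (a₁, 1)).2 with hb
  set A := (D (1, 0)).1 with hA
  set B := (D (1, 0)).2 with hB
  have hbase := (hlim _ _ (fun _ => 0) hid (isLittleO_zero _ _)).2
  simp only [add_zero] at hbase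
  have hbase1 : Tendsto (fun y => (σ (lam y, y)).1 / y) (𝓝[>] 0) (𝓝 (D (a₁, 1)).1) := by
    refine ((continuous_fst.tendsto _).comp hbase).congr fun y => ?_
    simp [div_eq_inv_mul]
  have hbase2 : Tendsto (fun y => (σ (lam y, y)).2 / y) (𝓝[>] 0) (𝓝 b) := by
    refine ((continuous_snd.tendsto _).comp hbase).congr fun y => ?_
    simp [div_eq_inv_mul]
  have hto0 : ∀ {l : Filter ℝ} {y Y : ℝ → ℝ}, Tendsto y l (𝓝[>] 0) →
      Tendsto (fun i => Y i / y i) l (𝓝 b) → Tendsto Y l (𝓝 0) := by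
    intro l y Y hy hY
    have := hY.mul (hzero hy)
    rw [mul_zero] at this
    refine this.congr' ?_
    filter_upwards [hpos hy] with i hi
    rw [div_mul_cancel₀ _ hi.ne']
  have hb0 : 0 ≤ b := by
    refine ge_of_tendsto hbase2 ?_
    filter_upwards [himage, self_mem_nhdsWithin] with y h1 h2
    exact div_nonneg h1.1 (Set.mem_Ioi.mp h2).le
  have hub : |(D (a₁, 1)).1| ≤ C * b := by
    refine le_of_tendsto_of_tendsto hbase1.abs (hbase2.const_mul C) ?_
    have hY : Tendsto (fun y => (σ (lam y, y)).2) (𝓝[>] 0) (𝓝[≥] 0) :=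
      tendsto_nhdsWithin_iff.mpr ⟨hto0 hid hbase2, himage.mono fun y h => h.1⟩
    filter_upwards [himage, hY.eventually hbound, self_mem_nhdsWithin] with y h1 h2 h3
    have h3 : 0 < y := h3
    rw [← h1.2] at h2
    rw [abs_div, abs_of_pos h3, ← mul_div_assoc]
    gcongr
  have hbpos : 0 < b := by
    refine hb0.lt_of_ne fun h => ?_
    rw [← h, mul_zero] at hub
    have h1 : (D (a₁, 1)).1 = 0 := abs_eq_zero.mp (le_antisymm hub (abs_nonneg _))
    have h2 : D (a₁, 1) = D 0 := by
      rw [map_zero]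
      exact Prod.ext h1 (hb ▸ h.symm)
    simpa using hD h2
  have hto0' : ∀ {l : Filter ℝ} {y Y : ℝ → ℝ}, Tendsto y l (𝓝[>] 0) →
      Tendsto (fun i => Y i / y i) l (𝓝 b) → Tendsto Y l (𝓝[>] 0) := by
    intro l y Y hy hY
    refine tendsto_nhdsWithin_iff.mpr ⟨hto0 hy hY, ?_⟩
    filter_upwards [hY.eventually (lt_mem_nhds hbpos), hpos hy] with i h1 h2
    exact (div_pos_iff_of_pos_right h2).mp h1
  have hu : (D (a₁, 1)).1 = a₁' * b := by
    have h1 := (hl'.comp (hto0' hid hbase2)).mul hbase2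
    refine tendsto_nhds_unique hbase1 (h1.congr' ?_)
    filter_upwards [himage, hpos (hto0' hid hbase2)] with y h1 h2
    rw [Function.comp_apply, h1.2, div_mul_div_cancel₀ h2.ne']
  have hdec : ∀ x y : ℝ, D (x, y) = x • D (1, 0) + y • D (0, 1) := by
    intro x y
    rw [← map_smul, ← map_smul, ← map_add]
    simp
  have hdet : LinearMap.det (D : (ℝ × ℝ) →ₗ[ℝ] (ℝ × ℝ)) = b * (A - a₁' * B) := by
    have h1 : a₁ * A + (D (0, 1)).1 = a₁' * b := by rw [← hu, hdec a₁ 1]; simp [hA]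
    have h2 : a₁ * B + (D (0, 1)).2 = b := by rw [hb, hdec a₁ 1]; simp [hB]
    rw [det_prod_eq, ← hA, ← hB]
    linear_combination A * h2 - B * h1
  refine ⟨b, A - a₁' * B, hbpos, ?_, hdet, ?_⟩
  · have hne : LinearMap.det (D : (ℝ × ℝ) →ₗ[ℝ] (ℝ × ℝ)) ≠ 0 := by
      have h1 := LinearMap.ker_eq_bot.mpr (show Function.Injective (D : (ℝ × ℝ) →ₗ[ℝ] (ℝ × ℝ)) from hD)
      intro h2
      exact (LinearMap.bot_lt_ker_of_det_eq_zero h2).ne' h1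
    rw [hdet] at hne
    exact right_ne_zero_of_mul hne
  · intro l y e hy he
    obtain ⟨hq0, hq1⟩ := hlim l y e hy he
    have hY : Tendsto (fun i => (σ (lam (y i) + e i, y i)).2 / y i) l (𝓝 b) := by
      refine ((continuous_snd.tendsto _).comp hq1).congr fun i => ?_
      simp [div_eq_inv_mul]
    refine ⟨hq0, hY, ?_⟩
    have hr0 := (hlim l y (fun _ => 0) hy (isLittleO_zero _ _)).1
    simp only [add_zero] at hr0
    have hs : (fun i => σ (lam (y i) + e i, y i) - σ (lam (y i), y i) - e i • D (1, 0)) =o[l] e := by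
      have h1 := hσ.isLittleO.comp_tendsto (hq0.prodMk_nhds hr0)
      have h2 : ((fun q : (ℝ × ℝ) × (ℝ × ℝ) => q.1 - q.2) ∘
          fun i => ((lam (y i) + e i, y i), (lam (y i), y i))) =O[l] e := by
        refine IsBigO.of_bound 1 (Eventually.of_forall fun i => ?_)
        simp [Prod.norm_def]
      refine (h1.trans_isBigO h2).congr_left fun i => ?_
      simp only [Function.comp_apply]
      have h3 : ((lam (y i) + e i, y i) : ℝ × ℝ) - (lam (y i), y i) = (e i, 0) := by simp
      rw [h3, hdec, zero_smul, add_zero]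
    have hs1 : (fun i => (σ (lam (y i) + e i, y i)).1 - (σ (lam (y i), y i)).1 - A * e i) =o[l] e := by
      refine ((isBigO_of_le _ fun i => norm_fst_le _).trans_isLittleO hs).congr_left fun i => ?_
      simp [hA, mul_comm]
    have hs2 : (fun i => (σ (lam (y i) + e i, y i)).2 - (σ (lam (y i), y i)).2 - B * e i) =o[l] e := by
      refine ((isBigO_of_le _ fun i => norm_snd_le _).trans_isLittleO hs).congr_left fun i => ?_
      simp [hB, mul_comm]
    have hdO : (fun i => (σ (lam (y i) + e i, y i)).2 - (σ (lam (y i), y i)).2) =O[l] e := by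
      have := hs2.isBigO.add ((isBigO_refl e l).const_mul_left B)
      exact this.congr_left fun i => by ring
    have h3 := (hstrict.comp_tendsto ((hto0' hy hY).prodMk (hto0' hid hbase2 |>.comp hy))).trans_isBigO hdO
    refine ((hs1.sub h3).sub (hs2.const_mul_left a₁')).congr' ?_ EventuallyEq.rfl
    filter_upwards [hy.eventually himage] with i hi
    simp only [Function.comp_apply]
    rw [← hi.2]
    ring

open Polynomial in
/-- The initial form of `f` relative to a root branch, at an exponent outside the group generated
by the smaller Puiseux exponents of the branch. -/
lemma exists_initial_form_of_branch {f : ℝ × ℝ → ℝ} (hf : AnalyticAt ℝ f 0) {m : ℕ}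
    (hm : iteratedFDeriv ℝ m f 0 (fun _ => ((1 : ℝ), (0 : ℝ))) ≠ 0)
    {lam μ : ℝ → ℝ} {N : ℕ} (hN : 0 < N) (hμ : AnalyticAt ℝ μ 0) (hμ0 : μ 0 = 0)
    (hlam : ∀ᶠ y in 𝓝[≥] (0 : ℝ), lam y = μ (y ^ ((N : ℝ)⁻¹)))
    (hroot : ∀ᶠ y in 𝓝[≥] (0 : ℝ), f (lam y, y) = 0)
    {M q p : ℕ} (hM : M = N * q) (hq : q ≠ 0) {α : ℚ} (hα : (p : ℚ) / M = α)
    (hαΓ : α ∉ AddSubgroup.closure (insert (1 : ℚ) {β ∈ PuiseuxSupport N μ | β < α})) :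
    ∃ (a : ℝ) (β : ℕ) (P : ℝ[X]), P ≠ 0 ∧ P.eval a = 0 ∧
      (∀ j, P.coeff j = 0 ∨ P.coeff (j + 1) = 0) ∧
      (∀ k : ℕ, (k : ℚ) / N = α → a = iteratedDeriv k μ 0 / k.factorial) ∧
      (α ∉ PuiseuxSupport N μ → a = 0) ∧
      ∀ z₀ : ℝ, Tendsto (fun r : ℝ × ℝ => f (lam (r.1 ^ M) + r.2 * r.1 ^ p, r.1 ^ M) / r.1 ^ β)
        (𝓝[>] 0 ×ˢ 𝓝 z₀) (𝓝 (P.eval (z₀ + a))) := by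
  have hM0 : M ≠ 0 := by
    rw [hM]
    positivity
  have hNQ : (N : ℚ) ≠ 0 := by positivity
  have hqQ : (q : ℚ) ≠ 0 := by positivity
  have hMQ : (M : ℚ) ≠ 0 := by positivity
  have hp0 : p ≠ 0 := by
    rintro rfl
    apply hαΓ
    rw [← hα, Nat.cast_zero, zero_div]
    exact zero_mem _
  have hfrac : ∀ k : ℕ, ((q * k : ℕ) : ℚ) / M = k / N := by
    intro k
    rw [hM]
    push_cast
    rw [mul_comm (N : ℚ), mul_div_mul_left _ _ hqQ]
  obtain ⟨L, a, hL0, hLi, hak, haq, hLlim⟩ := exists_puiseux_truncation hμ hμ0 hq p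
  let Γ : AddSubgroup ℤ :=
    (AddSubgroup.closure (insert (1 : ℚ) {β ∈ PuiseuxSupport N μ | β < α})).comap
      ((AddMonoidHom.mulRight ((M : ℚ)⁻¹)).comp (Int.castAddHom ℚ))
  have hΓ : ∀ i : ℕ, (i : ℤ) ∈ Γ ↔ (i : ℚ) / M ∈
      AddSubgroup.closure (insert (1 : ℚ) {β ∈ PuiseuxSupport N μ | β < α}) := by
    intro i
    simp [Γ, div_eq_mul_inv]
  obtain ⟨β, P, hP0, hPc, hPlim⟩ := exists_initial_form hf hm hM0 hp0 hL0 Γ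
    (fun i hi => by
      obtain ⟨k, rfl, h1, h2⟩ := hLi i hi
      rw [hΓ]
      refine AddSubgroup.subset_closure (Or.inr ⟨⟨k, h2, hfrac k⟩, ?_⟩)
      rw [← hα]
      gcongr)
    (by
      rw [hΓ, div_self hMQ]
      exact AddSubgroup.subset_closure (Or.inl rfl))
    (by rwa [hΓ, hα])
  have hto : Tendsto (fun t : ℝ => t ^ M) (𝓝[>] 0) (𝓝[≥] 0) := by
    refine tendsto_nhdsWithin_iff.mpr ⟨?_, ?_⟩
    · have := ((continuous_pow M).tendsto (0 : ℝ)).mono_left (nhdsWithin_le_nhds (s := Set.Ioi 0))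
      simpa [hM0] using this
    · filter_upwards [self_mem_nhdsWithin] with s hs
      exact pow_nonneg (Set.mem_Ioi.mp hs).le M
  have hlamM : ∀ᶠ t in 𝓝[>] (0 : ℝ), lam (t ^ M) = μ (t ^ q) := by
    filter_upwards [hto.eventually hlam, self_mem_nhdsWithin] with t h1 h2
    rw [h1, hM, mul_comm, pow_mul, Real.pow_rpow_inv_natCast _ hN.ne']
    exact pow_nonneg (Set.mem_Ioi.mp h2).le q
  have hlim : ∀ z₀ : ℝ, Tendsto
      (fun r : ℝ × ℝ => f (lam (r.1 ^ M) + r.2 * r.1 ^ p, r.1 ^ M) / r.1 ^ β)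
        (𝓝[>] 0 ×ˢ 𝓝 z₀) (𝓝 (P.eval (z₀ + a))) := by
    intro z₀
    have hfst : Tendsto (fun r : ℝ × ℝ => r.1) (𝓝[>] 0 ×ˢ 𝓝 z₀) (𝓝[>] 0) := tendsto_fst
    have hw : Tendsto (fun r : ℝ × ℝ => r.2 + (μ (r.1 ^ q) - L.eval r.1) / r.1 ^ p)
        (𝓝[>] 0 ×ˢ 𝓝 z₀) (𝓝 (z₀ + a)) := tendsto_snd.add (hLlim.comp hfst)
    refine ((hPlim (z₀ + a)).comp (hfst.prodMk hw)).congr' ?_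
    filter_upwards [hfst.eventually hlamM, hfst.eventually self_mem_nhdsWithin] with r h1 h2
    have h2 : 0 < r.1 := h2
    have h3 : L.eval r.1 + (r.2 + (μ (r.1 ^ q) - L.eval r.1) / r.1 ^ p) * r.1 ^ p =
        lam (r.1 ^ M) + r.2 * r.1 ^ p := by
      rw [h1, add_mul, div_mul_cancel₀ _ (by positivity)]
      ring
    simp only [Function.comp_apply, h3]
  have hak' : ∀ k : ℕ, (k : ℚ) / N = α → a = iteratedDeriv k μ 0 / k.factorial := by
    intro k hk
    refine hak k ?_
    rw [← hα, ← hfrac k, div_left_inj' hMQ] at hk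
    exact_mod_cast hk
  refine ⟨a, β, P, hP0, ?_, hPc, hak', ?_, hlim⟩
  · have h1 := (hlim 0).comp (tendsto_id.prodMk (tendsto_const_nhds (f := 𝓝[>] (0 : ℝ))))
    rw [zero_add] at h1
    refine tendsto_nhds_unique h1 (tendsto_const_nhds.congr' ?_)
    filter_upwards [hto.eventually hroot] with t ht
    simp [ht]
  · intro hα'
    by_cases hqp : q ∣ p
    · obtain ⟨k, rfl⟩ := hqp
      have hk : (k : ℚ) / N = α := by rw [← hfrac, hα]
      rw [hak' k hk]
      by_contra h
      exact hα' ⟨k, fun h0 => h (by rw [h0, zero_div]), hk.symm⟩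
    · exact haq hqp

lemma closure_puiseuxSupport_eq {N : ℕ} (hN : 0 < N) (μ : ℝ → ℝ) (α : ℚ) :
    AddSubgroup.closure (insert (1 : ℚ) {β ∈ PuiseuxSupport N μ | β < α}) =
      AddSubgroup.closure (insert (1 : ℚ) {β | IsCharExponent N μ β ∧ β < α}) := by
  have hNQ : (0 : ℚ) < N := by positivity
  apply le_antisymm
  · rw [AddSubgroup.closure_le]
    rintro β (rfl | ⟨⟨k, hk, rfl⟩, hβ⟩)
    · exact AddSubgroup.subset_closure (Or.inl rfl)
    induction k using Nat.strong_induction_on with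
    | _ k ih =>
      by_cases hchar : IsCharExponent N μ ((k : ℚ) / N)
      · exact AddSubgroup.subset_closure (Or.inr ⟨hchar, hβ⟩)
      · have hmem : (k : ℚ) / N ∈ AddSubgroup.closure
            (insert (1 : ℚ) {β ∈ PuiseuxSupport N μ | β < (k : ℚ) / N}) := by
          by_contra h
          exact hchar ⟨⟨k, hk, rfl⟩, h⟩
        refine (AddSubgroup.closure_le _).mpr ?_ hmem
        rintro γ (rfl | ⟨⟨j, hj, rfl⟩, hγ⟩)
        · exact AddSubgroup.subset_closure (Or.inl rfl)
        · refine ih j ?_ hj (hγ.trans hβ)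
          rw [div_lt_div_iff_of_pos_right hNQ] at hγ
          exact_mod_cast hγ
  · apply AddSubgroup.closure_mono
    exact Set.insert_subset_insert fun β hβ => ⟨hβ.1.1, hβ.2⟩

open Polynomial Asymptotics in
/-- The coefficients of `y ^ α` in a branch and in its image under a `C¹` diffeomorphism are
proportional, at an exponent outside the groups generated by the smaller Puiseux exponents. -/
lemma exists_coeff_relation {σ : ℝ × ℝ → ℝ × ℝ} {D : ℝ × ℝ →L[ℝ] ℝ × ℝ}
    (hσ : HasStrictFDerivAt σ D 0) (hσ0 : σ 0 = 0) (hD : Function.Injective D)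
    {f g : ℝ × ℝ → ℝ} (hfa : AnalyticAt ℝ f 0) (hga : AnalyticAt ℝ g 0) {m m' : ℕ}
    (hfm : iteratedFDeriv ℝ m f 0 (fun _ => ((1 : ℝ), (0 : ℝ))) ≠ 0)
    (hgm : iteratedFDeriv ℝ m' g 0 (fun _ => ((1 : ℝ), (0 : ℝ))) ≠ 0)
    (hfg : ∀ᶠ p in 𝓝 (0 : ℝ × ℝ), f p = g (σ p))
    {lam lam' : ℝ → ℝ} {N N' : ℕ} {μ μ' : ℝ → ℝ}
    (hN : 0 < N) (hN' : 0 < N')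
    (hμ : AnalyticAt ℝ μ 0) (hμ0 : μ 0 = 0)
    (hμ' : AnalyticAt ℝ μ' 0) (hμ'0 : μ' 0 = 0)
    (hlam : ∀ᶠ y in 𝓝[≥] (0 : ℝ), lam y = μ (y ^ ((N : ℝ)⁻¹)))
    (hlam' : ∀ᶠ y in 𝓝[≥] (0 : ℝ), lam' y = μ' (y ^ ((N' : ℝ)⁻¹)))
    (hallow : ∃ C > (0 : ℝ), ∀ᶠ y in 𝓝[≥] (0 : ℝ), |lam y| ≤ C * y)
    (hallow' : ∃ C > (0 : ℝ), ∀ᶠ y in 𝓝[≥] (0 : ℝ), |lam' y| ≤ C * y)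
    (hroot : ∀ᶠ y in 𝓝[≥] (0 : ℝ), f (lam y, y) = 0)
    (hroot' : ∀ᶠ y in 𝓝[≥] (0 : ℝ), g (lam' y, y) = 0)
    (himage : ∀ᶠ y in 𝓝[>] (0 : ℝ),
      0 ≤ (σ (lam y, y)).2 ∧ (σ (lam y, y)).1 = lam' (σ (lam y, y)).2)
    {p : ℕ} {α : ℚ} (hα : (p : ℚ) / (N * N' : ℕ) = α) (hα1 : 1 < α)
    (hαΓ : α ∉ AddSubgroup.closure (insert (1 : ℚ) {β ∈ PuiseuxSupport N μ | β < α}))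
    (hαΓ' : α ∉ AddSubgroup.closure (insert (1 : ℚ) {β ∈ PuiseuxSupport N' μ' | β < α})) :
    ∃ a a' c : ℝ, c * a = a' ∧ c ≠ 0 ∧
      (0 < LinearMap.det (D : (ℝ × ℝ) →ₗ[ℝ] (ℝ × ℝ)) → 0 < c) ∧
      (∀ k : ℕ, (k : ℚ) / N = α → a = iteratedDeriv k μ 0 / k.factorial) ∧
      (α ∉ PuiseuxSupport N μ → a = 0) ∧
      (∀ k : ℕ, (k : ℚ) / N' = α → a' = iteratedDeriv k μ' 0 / k.factorial) ∧
      (α ∉ PuiseuxSupport N' μ' → a' = 0) := by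
  obtain ⟨-, h, hh, hlh⟩ := exists_eq_pow_mul_of_allowable hμ hN hlam hallow
  obtain ⟨-, h', hh', hlh'⟩ := exists_eq_pow_mul_of_allowable hμ' hN' hlam' hallow'
  have htan : ∀ {l h : ℝ → ℝ} {n : ℕ}, 0 < n → AnalyticAt ℝ h 0 →
      (∀ᶠ y in 𝓝[≥] (0 : ℝ), l y = y * h (y ^ ((n : ℝ)⁻¹))) →
      Tendsto (fun y => l y / y) (𝓝[>] 0) (𝓝 (h 0)) := by
    intro l h n hn hh hl
    have hr : Tendsto (fun y : ℝ => y ^ ((n : ℝ)⁻¹)) (𝓝[>] 0) (𝓝 0) := by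
      have := (Real.continuousAt_rpow_const (0 : ℝ) ((n : ℝ)⁻¹) (Or.inr (by positivity))).tendsto
      rw [Real.zero_rpow (by positivity)] at this
      exact this.mono_left nhdsWithin_le_nhds
    refine (hh.continuousAt.tendsto.comp hr).congr' ?_
    filter_upwards [nhdsWithin_mono _ Set.Ioi_subset_Ici_self hl, self_mem_nhdsWithin] with y h1 h2
    rw [h1, mul_div_cancel_left₀ _ (Set.mem_Ioi.mp h2).ne', Function.comp_apply]
  have hlh'' : ∀ᶠ y in 𝓝[>] (0 : ℝ), lam' y = y * h' (y ^ ((N' : ℝ)⁻¹)) :=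
    nhdsWithin_mono _ Set.Ioi_subset_Ici_self hlh'
  have hstrict : (fun q : ℝ × ℝ => lam' q.1 - lam' q.2 - h' 0 * (q.1 - q.2))
      =o[𝓝[>] 0 ×ˢ 𝓝[>] 0] fun q => q.1 - q.2 := by
    refine (isLittleO_branch_sub hh' hN').congr' ?_ EventuallyEq.rfl
    filter_upwards [tendsto_fst.eventually hlh'', tendsto_snd.eventually hlh''] with q h1 h2
    rw [h1, h2]
  obtain ⟨C, -, hC⟩ := hallow'
  obtain ⟨b, c₀, hb, hc₀, hdet, hshift⟩ := exists_horizontal_displacement hσ hσ0 hD (htan hN hh hlh)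
    hC (htan hN' hh' hlh') hstrict himage
  obtain ⟨a, β, P, hP0, hPa, hPc, hak, has, hPlim⟩ := exists_initial_form_of_branch hfa hfm hN hμ
    hμ0 hlam hroot rfl hN'.ne' hα hαΓ
  obtain ⟨a', β', P', hP'0, -, hP'c, hak', has', hP'lim⟩ := exists_initial_form_of_branch hga hgm
    hN' hμ' hμ'0 hlam' hroot' (mul_comm N N') hN.ne' hα hαΓ'
  set M := N * N' with hMdef
  have hM : M ≠ 0 := by positivity
  have hMp : M < p := by
    have hMQ : (0 : ℚ) < M := by positivity
    rw [← hα, lt_div_iff₀ hMQ, one_mul] at hα1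
    exact_mod_cast hα1
  let r : ℝ := b ^ ((M : ℝ)⁻¹)
  have hr : 0 < r := Real.rpow_pos_of_pos hb _
  have hid : Tendsto (fun t : ℝ => t) (𝓝[>] 0) (𝓝 0) := tendsto_id'.mpr nhdsWithin_le_nhds
  have hpos : ∀ᶠ t in 𝓝[>] (0 : ℝ), 0 < t := self_mem_nhdsWithin
  have hto : Tendsto (fun t : ℝ => t ^ M) (𝓝[>] 0) (𝓝[>] 0) := by
    refine tendsto_nhdsWithin_iff.mpr ⟨?_, hpos.mono fun t ht => pow_pos ht M⟩
    simpa [hM] using hid.pow M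
  -- The values of `f` along a displaced branch, expressed through `g` along the image branch.
  have hkey : ∀ z : ℝ, ∃ T : ℝ → ℝ, Tendsto (fun t => T t / t) (𝓝[>] 0) (𝓝 r) ∧
      (∀ᶠ t in 𝓝[>] (0 : ℝ), 0 < T t) ∧
      Tendsto (fun t => f (lam (t ^ M) + z * t ^ p, t ^ M) / t ^ β) (𝓝[>] 0)
        (𝓝 (P.eval (z + a))) ∧
      Tendsto (fun t => f (lam (t ^ M) + z * t ^ p, t ^ M) / T t ^ β') (𝓝[>] 0)
        (𝓝 (P'.eval (c₀ / r ^ p * z + a'))) := by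
    intro z
    have he : (fun t : ℝ => z * t ^ p) =o[𝓝[>] 0] fun t => t ^ M :=
      ((isLittleO_pow_pow hMp).comp_tendsto hid).const_mul_left z
    obtain ⟨hq0, hY, hX⟩ := hshift _ _ _ hto he
    let Q : ℝ → ℝ × ℝ := fun t => σ (lam (t ^ M) + z * t ^ p, t ^ M)
    change Tendsto (fun t => (Q t).2 / t ^ M) _ _ at hY
    change (fun t => (Q t).1 - lam' (Q t).2 - c₀ * (z * t ^ p)) =o[_] _ at hX
    let T : ℝ → ℝ := fun t => (Q t).2 ^ ((M : ℝ)⁻¹)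
    have hQpos : ∀ᶠ t in 𝓝[>] (0 : ℝ), 0 < (Q t).2 := by
      filter_upwards [hY.eventually (lt_mem_nhds hb), hpos] with t h1 h2
      exact (div_pos_iff_of_pos_right (pow_pos h2 M)).mp h1
    have hTpos : ∀ᶠ t in 𝓝[>] (0 : ℝ), 0 < T t := hQpos.mono fun t ht => Real.rpow_pos_of_pos ht _
    have hTM : ∀ᶠ t in 𝓝[>] (0 : ℝ), T t ^ M = (Q t).2 :=
      hQpos.mono fun t ht => Real.rpow_inv_natCast_pow ht.le hM
    have hT : Tendsto (fun t => T t / t) (𝓝[>] 0) (𝓝 r) := by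
      refine (hY.rpow_const (p := (M : ℝ)⁻¹) (Or.inl hb.ne')).congr' ?_
      filter_upwards [hQpos, hpos] with t h1 h2
      rw [Real.div_rpow h1.le (pow_pos h2 M).le, Real.pow_rpow_inv_natCast h2.le hM]
    have hT0 : Tendsto T (𝓝[>] 0) (𝓝[>] 0) := by
      refine tendsto_nhdsWithin_iff.mpr ⟨?_, hTpos⟩
      have := hT.mul hid
      rw [mul_zero] at this
      refine this.congr' ?_
      filter_upwards [hpos] with t ht
      rw [div_mul_cancel₀ _ ht.ne']
    let Z : ℝ → ℝ := fun t => ((Q t).1 - lam' (Q t).2) / T t ^ p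
    have hZ : Tendsto Z (𝓝[>] 0) (𝓝 (c₀ / r ^ p * z)) := by
      have hX' : (fun t => (Q t).1 - lam' (Q t).2 - c₀ * (z * t ^ p)) =o[𝓝[>] 0] fun t => t ^ p :=
        hX.trans_isBigO ((isBigO_refl _ _).const_mul_left z)
      have h1 := (hX'.tendsto_div_nhds_zero.add_const (c₀ * z)).div (hT.pow p)
        (pow_pos hr p).ne'
      rw [zero_add, ← div_mul_eq_mul_div] at h1
      refine h1.congr' ?_
      filter_upwards [hpos, hTpos] with t h2 h3
      have := h2.ne'
      have := h3.ne'
      simp only [Z, Pi.div_apply, div_pow]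
      field_simp
      ring
    refine ⟨T, hT, hTpos, ?_, ?_⟩
    · exact (hPlim z).comp (tendsto_id.prodMk tendsto_const_nhds)
    · refine ((hP'lim _).comp (hT0.prodMk hZ)).congr' ?_
      filter_upwards [hq0.eventually hfg, hTM, hTpos] with t h1 h2 h3
      simp only [Function.comp_apply]
      rw [h1, h2, div_mul_cancel₀ _ (pow_pos h3 p).ne', add_sub_cancel]
  have hc : c₀ / r ^ p ≠ 0 := div_ne_zero hc₀ (pow_pos hr p).ne'
  have hββ' : β = β' := by
    rcases lt_trichotomy β β' with hlt | heq | hlt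
    · refine absurd (Polynomial.funext fun v => ?_) hP0
      obtain ⟨T, hT, hTpos, h1, h2⟩ := hkey (v - a)
      obtain ⟨d, rfl⟩ := Nat.exists_eq_add_of_lt hlt
      have h3 := (h2.mul (hT.pow (β + d + 1))).mul (hid.pow (d + 1))
      rw [zero_pow (Nat.succ_ne_zero d), mul_zero] at h3
      rw [sub_add_cancel] at h1
      rw [eval_zero]
      refine tendsto_nhds_unique h1 (h3.congr' ?_)
      filter_upwards [hpos, hTpos] with t h4 h5
      have := h4.ne'
      have := h5.ne'
      simp only [div_pow, add_assoc β d 1, pow_add _ β]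
      generalize f _ = w
      field_simp
    · exact heq
    · refine absurd (Polynomial.funext fun v => ?_) hP'0
      obtain ⟨T, hT, hTpos, h1, h2⟩ := hkey ((v - a') / (c₀ / r ^ p))
      obtain ⟨d, rfl⟩ := Nat.exists_eq_add_of_lt hlt
      have h3 := (h1.div (hT.pow β') (pow_pos hr _).ne').mul (hid.pow (d + 1))
      rw [zero_pow (Nat.succ_ne_zero d), mul_zero] at h3
      rw [mul_div_cancel₀ _ hc, sub_add_cancel] at h2
      rw [eval_zero]
      refine tendsto_nhds_unique h2 (h3.congr' ?_)
      filter_upwards [hpos, hTpos] with t h4 h5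
      have := h4.ne'
      have := h5.ne'
      simp only [Pi.div_apply, div_pow, add_assoc β' d 1, pow_add _ β']
      generalize f _ = w
      field_simp
  subst hββ'
  have hrel : ∀ v, P.eval v = r ^ β * P'.eval (c₀ / r ^ p * v + (a' - c₀ / r ^ p * a)) := by
    intro v
    obtain ⟨T, hT, hTpos, h1, h2⟩ := hkey (v - a)
    rw [sub_add_cancel] at h1
    have h3 := (hT.pow β).mul h2
    have h4 : c₀ / r ^ p * (v - a) + a' = c₀ / r ^ p * v + (a' - c₀ / r ^ p * a) := by ring
    rw [h4] at h3
    refine tendsto_nhds_unique h1 (h3.congr' ?_)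
    filter_upwards [hpos, hTpos] with t h4 h5
    have := h4.ne'
    have := h5.ne'
    simp only [div_pow]
    generalize f _ = w
    field_simp
  have hPdeg : P.natDegree ≠ 0 := by
    intro h0
    rw [eq_C_of_natDegree_eq_zero h0, eval_C] at hPa
    exact hP0 (by rw [eq_C_of_natDegree_eq_zero h0, hPa, C_0])
  have hae := translation_eq_zero_of_eval_eq hc hrel hPdeg hPc hP'c
  refine ⟨a, a', c₀ / r ^ p, (sub_eq_zero.mp hae).symm, hc, fun hpd => ?_, hak, has, hak', has'⟩
  rw [hdet] at hpd
  exact div_pos (pos_of_mul_pos_right hpd hb.le) (pow_pos hr p)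

lemma IsC1DiffeoGerm.hasStrictFDerivAt {E : Type*} [NormedAddCommGroup E] [NormedSpace ℝ E]
    {σ : E → E} (hσ : IsC1DiffeoGerm σ) : HasStrictFDerivAt σ (fderiv ℝ σ 0) 0 := by
  obtain ⟨-, U, -, -, hU, -, h0, -, -, -, -, -, hc, -⟩ := hσ
  exact (hc.contDiffAt (hU.mem_nhds h0)).hasStrictFDerivAt one_ne_zero

lemma IsC1DiffeoGerm.injective_fderiv {E : Type*} [NormedAddCommGroup E] [NormedSpace ℝ E]
    {σ : E → E} (hσ : IsC1DiffeoGerm σ) : Function.Injective (fderiv ℝ σ 0) := by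
  have hd := hσ.hasStrictFDerivAt.hasFDerivAt
  obtain ⟨hσ0, U, V, τ, hU, hV, hU0, hV0, -, -, hτσ, -, -, hcτ⟩ := hσ
  have hτ : HasFDerivAt τ (fderiv ℝ τ 0) (σ 0) := by
    rw [hσ0]
    exact ((hcτ.contDiffAt (hV.mem_nhds hV0)).differentiableAt one_ne_zero).hasFDerivAt
  have hid : HasFDerivAt (τ ∘ σ) (ContinuousLinearMap.id ℝ E) 0 :=
    (hasFDerivAt_id 0).congr_of_eventuallyEq
      (Filter.eventuallyEq_of_mem (hU.mem_nhds hU0) fun x hx => hτσ x hx)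
  have hcomp := (hτ.comp 0 hd).unique hid
  exact Function.LeftInverse.injective (g := fderiv ℝ τ 0) fun v => DFunLike.congr_fun hcomp v

lemma eventually_mem_branchSet {σ : ℝ × ℝ → ℝ × ℝ} {lam lam' : ℝ → ℝ} {U : Set (ℝ × ℝ)}
    (hU : IsOpen U) (hU0 : (0 : ℝ × ℝ) ∈ U)
    (himage : σ '' (branchSet lam ∩ U) = branchSet lam' ∩ (σ '' U))
    (hallow : ∃ C > (0 : ℝ), ∀ᶠ y in 𝓝[≥] (0 : ℝ), |lam y| ≤ C * y) :
    ∀ᶠ y in 𝓝[>] (0 : ℝ), 0 ≤ (σ (lam y, y)).2 ∧ (σ (lam y, y)).1 = lam' (σ (lam y, y)).2 := by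
  obtain ⟨C, -, hC⟩ := hallow
  have hC' := nhdsWithin_mono (0 : ℝ) Set.Ioi_subset_Ici_self hC
  have hid : Tendsto (fun y : ℝ => y) (𝓝[>] 0) (𝓝 0) := tendsto_id'.mpr nhdsWithin_le_nhds
  have hlam : Tendsto lam (𝓝[>] 0) (𝓝 0) := by
    refine squeeze_zero_norm' hC' ?_
    simpa using hid.const_mul C
  filter_upwards [(hlam.prodMk_nhds hid).eventually (hU.mem_nhds hU0), self_mem_nhdsWithin]
    with y h1 h2
  have hmem : σ (lam y, y) ∈ branchSet lam' ∩ (σ '' U) := by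
    rw [← himage]
    exact ⟨_, ⟨⟨(Set.mem_Ioi.mp h2).le, rfl⟩, h1⟩, rfl⟩
  exact hmem.1

lemma IsCharExponent.one_lt {N : ℕ} (hN : 0 < N) {μ : ℝ → ℝ}
    (hμ : ∀ k < N, iteratedDeriv k μ 0 = 0) {α : ℚ} (hα : IsCharExponent N μ α) : 1 < α := by
  have hNQ : (0 : ℚ) < N := by positivity
  obtain ⟨⟨k, hk, rfl⟩, hcl⟩ := hα
  refine lt_of_le_of_ne ?_ fun h => hcl ?_
  · rw [le_div_iff₀ hNQ, one_mul]
    exact_mod_cast not_lt.mp fun h => hk (hμ k h)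
  · rw [← h]
    exact AddSubgroup.subset_closure (Or.inl rfl)

/-- C¹ invariance of the Puiseux characteristic exponents of Newton–Puiseux roots, and of the
signs of the characteristic coefficients when `det Dσ(0) > 0`. -/
theorem stmt10 (σ : ℝ × ℝ → ℝ × ℝ) (hσ : IsC1DiffeoGerm σ)
    (f g : ℝ × ℝ → ℝ) (hfa : AnalyticAt ℝ f 0) (hga : AnalyticAt ℝ g 0)
    (hf0 : f 0 = 0) (hg0 : g 0 = 0)
    (hfne : ¬ ∀ᶠ p in 𝓝 (0 : ℝ × ℝ), f p = 0) (hgne : ¬ ∀ᶠ p in 𝓝 (0 : ℝ × ℝ), g p = 0)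
    (hfmr : ∃ m : ℕ, (∀ j < m, iteratedFDeriv ℝ j f 0 = 0) ∧
      iteratedFDeriv ℝ m f 0 (fun _ => ((1 : ℝ), (0 : ℝ))) ≠ 0)
    (hgmr : ∃ m : ℕ, (∀ j < m, iteratedFDeriv ℝ j g 0 = 0) ∧
      iteratedFDeriv ℝ m g 0 (fun _ => ((1 : ℝ), (0 : ℝ))) ≠ 0)
    (hfg : ∀ᶠ p in 𝓝 (0 : ℝ × ℝ), f p = g (σ p))
    (lam lam' : ℝ → ℝ) (N N' : ℕ) (μ μ' : ℝ → ℝ)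
    (hN : 0 < N) (hN' : 0 < N')
    (hμ : AnalyticAt ℝ μ 0) (hμ0 : μ 0 = 0)
    (hμ' : AnalyticAt ℝ μ' 0) (hμ'0 : μ' 0 = 0)
    (hlam : ∀ᶠ y in 𝓝[≥] (0 : ℝ), lam y = μ (y ^ ((N : ℝ)⁻¹)))
    (hlam' : ∀ᶠ y in 𝓝[≥] (0 : ℝ), lam' y = μ' (y ^ ((N' : ℝ)⁻¹)))
    (hallow : ∃ C > (0 : ℝ), ∀ᶠ y in 𝓝[≥] (0 : ℝ), |lam y| ≤ C * y)
    (hallow' : ∃ C > (0 : ℝ), ∀ᶠ y in 𝓝[≥] (0 : ℝ), |lam' y| ≤ C * y)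
    (hroot : ∀ᶠ y in 𝓝[≥] (0 : ℝ), f (lam y, y) = 0)
    (hroot' : ∀ᶠ y in 𝓝[≥] (0 : ℝ), g (lam' y, y) = 0)
    (himage : ∃ U : Set (ℝ × ℝ), IsOpen U ∧ (0 : ℝ × ℝ) ∈ U ∧
      σ '' (branchSet lam ∩ U) = branchSet lam' ∩ (σ '' U)) :
    (∀ α : ℚ, IsCharExponent N μ α ↔ IsCharExponent N' μ' α) ∧
      (0 < LinearMap.det ((fderiv ℝ σ 0) : (ℝ × ℝ) →ₗ[ℝ] (ℝ × ℝ)) →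
        ∀ α : ℚ, IsCharExponent N μ α →
          ∀ k k' : ℕ, (k : ℚ) / (N : ℚ) = α → (k' : ℚ) / (N' : ℚ) = α →
            (0 < iteratedDeriv k μ 0 ↔ 0 < iteratedDeriv k' μ' 0)) := by
  obtain ⟨mf, -, hfm⟩ := hfmr
  obtain ⟨mg, -, hgm⟩ := hgmr
  obtain ⟨U, hU, hU0, hσU⟩ := himage
  have hlow := (exists_eq_pow_mul_of_allowable hμ hN hlam hallow).1
  have hlow' := (exists_eq_pow_mul_of_allowable hμ' hN' hlam' hallow').1
  have hNQ : (N : ℚ) ≠ 0 := by positivity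
  have hNQ' : (N' : ℚ) ≠ 0 := by positivity
  have hrel := fun (p : ℕ) (α : ℚ) => exists_coeff_relation hσ.hasStrictFDerivAt hσ.1
    hσ.injective_fderiv hfa hga hfm hgm hfg hN hN' hμ hμ0 hμ' hμ'0 hlam hlam' hallow hallow'
    hroot hroot' (eventually_mem_branchSet hU hU0 hσU hallow) (p := p) (α := α)
  have hfrac : ∀ {α : ℚ}, IsCharExponent N μ α → ∃ p : ℕ, (p : ℚ) / (N * N' : ℕ) = α := by
    rintro _ ⟨⟨k, -, rfl⟩, -⟩
    refine ⟨k * N', ?_⟩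
    push_cast
    field_simp
  have hfrac' : ∀ {α : ℚ}, IsCharExponent N' μ' α → ∃ p : ℕ, (p : ℚ) / (N * N' : ℕ) = α := by
    rintro _ ⟨⟨k, -, rfl⟩, -⟩
    refine ⟨k * N, ?_⟩
    push_cast
    field_simp
  have hdiv : ∀ {ν : ℝ → ℝ} {n : ℕ}, iteratedDeriv n ν 0 ≠ 0 →
      iteratedDeriv n ν 0 / n.factorial ≠ 0 :=
    fun h => div_ne_zero h (Nat.cast_ne_zero.mpr (Nat.factorial_ne_zero _))
  have hiff : ∀ p : ℕ, IsCharExponent N μ ((p : ℚ) / (N * N' : ℕ)) ↔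
      IsCharExponent N' μ' ((p : ℚ) / (N * N' : ℕ)) := by
    intro p
    induction p using Nat.strong_induction_on with
    | _ p ih =>
      have hlt : ∀ {q : ℕ}, (q : ℚ) / (N * N' : ℕ) < (p : ℚ) / (N * N' : ℕ) → q < p := by
        intro q hq
        rw [div_lt_div_iff_of_pos_right (by positivity)] at hq
        exact_mod_cast hq
      have hset : {β | IsCharExponent N μ β ∧ β < (p : ℚ) / (N * N' : ℕ)} =
          {β | IsCharExponent N' μ' β ∧ β < (p : ℚ) / (N * N' : ℕ)} := by
        ext β
        refine and_congr_left fun hβ => ⟨fun h => ?_, fun h => ?_⟩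
        · obtain ⟨q, rfl⟩ := hfrac h
          exact (ih q (hlt hβ)).mp h
        · obtain ⟨q, rfl⟩ := hfrac' h
          exact (ih q (hlt hβ)).mpr h
      have hclosure := closure_puiseuxSupport_eq hN μ ((p : ℚ) / (N * N' : ℕ))
      rw [hset, ← closure_puiseuxSupport_eq hN'] at hclosure
      constructor
      · intro h
        have hcl := h.2
        rw [hclosure] at hcl
        obtain ⟨a, a', c, hca, hc, -, hak, -, -, has'⟩ :=
          hrel p _ rfl (h.one_lt hN hlow) h.2 hcl
        refine ⟨?_, hcl⟩
        by_contra hmem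
        obtain ⟨k, hk, hkα⟩ := h.1
        refine mul_ne_zero hc (?_ : a ≠ 0) (hca.trans (has' hmem))
        rw [hak k hkα.symm]
        exact hdiv hk
      · intro h
        have hcl := h.2
        rw [← hclosure] at hcl
        obtain ⟨a, a', c, hca, -, -, -, has, hak', -⟩ :=
          hrel p _ rfl (h.one_lt hN' hlow') hcl h.2
        refine ⟨?_, hcl⟩
        by_contra hmem
        obtain ⟨k, hk, hkα⟩ := h.1
        refine (?_ : a' ≠ 0) (by rw [← hca, has hmem, mul_zero])
        rw [hak' k hkα.symm]
        exact hdiv hk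
  have hchar : ∀ α : ℚ, IsCharExponent N μ α ↔ IsCharExponent N' μ' α := by
    refine fun α => ⟨fun h => ?_, fun h => ?_⟩
    · obtain ⟨p, rfl⟩ := hfrac h
      exact (hiff p).mp h
    · obtain ⟨p, rfl⟩ := hfrac' h
      exact (hiff p).mpr h
  refine ⟨hchar, fun hdet α h k k' hk hk' => ?_⟩
  obtain ⟨p, hp⟩ := hfrac h
  obtain ⟨a, a', c, hca, -, hcpos, hak, -, hak', -⟩ :=
    hrel p α hp (h.one_lt hN hlow) h.2 ((hchar α).mp h).2
  have hsign : 0 < a ↔ 0 < a' := by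
    rw [← hca, mul_pos_iff_of_pos_left (hcpos hdet)]
  rwa [hak k hk, hak' k' hk', div_pos_iff_of_pos_right (by positivity),
    div_pos_iff_of_pos_right (by positivity)] at hsign
end
end
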